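/- Let $k$ be an algebraically closed field, let $V\subseteq\mathbb P^n$ be a smooth projective variety over $k$ (irreducible, with homogeneous ideal $I(V)\subseteq k[x_0,\dots,x_n]$), let $m\ge 0$ and let $H\subset\mathbb P^m$ be a hyperplane. Via the Segre embedding $([x],[y])\mapsto[x_iy_j]$, with homogeneous coordinates $z_{ij}$ ($0\le i\le n$, $0\le j\le m$) on $\mathbb P^N$, $N=(n+1)(m+1)-1$, regard $V\times H\subset V\times\mathbb P^m\subset\mathbb P^N$. Let $Y_{\mathbb P}=C(V\times\mathbb P^m)\subset\mathbb A^{N+1}$ and $Z_{\mathbb P}=C(V\times H)\subset Y_{\mathbb P}$ be the affine cones (with $C(\emptyset)$ the origin, so that $Z_{\mathbb P}=\{v\}$ if $m=0$), let $v$ be their common vertex, $\mathfrak m_v$ its maximal ideal in the affine coordinate ring $k[Y_{\mathbb P}]$, $I\subseteq k[Y_{\mathbb P}]$ the ideal of $Z_{\mathbb P}$, and let $f_{\mathbb P}:X_{\mathbb P}=\operatorname{Proj}\bigl(\bigoplus_{d\ge0}I^d\bigr)\to Y_{\mathbb P}$ be the blowing up of $Y_{\mathbb P}$ along $Z_{\mathbb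 P}$. Then: 1. $f_{\mathbb P}$ is an isomorphism over $Y_{\mathbb P}\setminus\{v\}$. 2. The scheme-theoretic preimage $f_{\mathbb P}^{-1}(v)$ is isomorphic to $V$ over $k$. If $V$ is not a single point, its support is the exceptional locus of $f_{\mathbb P}$, i.e. the set of points of $X_{\mathbb P}$ at which $f_{\mathbb P}$ is not a local isomorphism. 3. There are homogeneous coordinates $y'_j=\sum_l A_{jl}y_l$ on $\mathbb P^m$, with $A\in GL_{m+1}(k)$, such that $H=(y'_m=0)$ and such that, for the corresponding Segre coordinates $z'_{ij}=\sum_l A_{jl}z_{il}$ on $\mathbb P^N$, the ideal $I$ is generated by $z'_{0m},\dots,z'_{nm}$ and there is an isomorphism of graded $k$-algebras $\bigoplus_{d\ge0}I^d/I^d\mathfrak m_v\cong k[x_0,\dots,x_n]/I(V)$ that sends the class of $z'_{im}$ in degree $1$ to the class of $x_i$ for every $i$; that is, the left-hand side is the polynomial ring $k[z'_{0m},\dots,z'_{nm}]$ modulo the equations of $V$. 4. $\operatorname{Proj}\bigl(\bigoplus_{d\ge0}I^d/I^d\mathfrak m_v\bigr)\cong V$ over $k$. -/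

import Mathlib

universe u

open CategoryTheory AlgebraicGeometry
open scoped LinearAlgebra.Projectivization

namespace ConeBlowup

noncomputable section

section Gradings

variable {R A : Type u} [CommRing R] [CommRing A] [Algebra R A]

/-- A family of submodules that multiplies correctly and into which the algebra splits as an
internal direct sum is a grading. -/
@[reducible]
def gradedOfIsInternal (𝒜 : ℕ → Submodule R A) (h1 : SetLike.GradedMonoid 𝒜)
    (h2 : DirectSum.IsInternal 𝒜) : GradedAlgebra 𝒜 :=
  letI := h2.chooseDecomposition
  { h1 with }

/-- A family of submodules is an internal direct sum as soon as there are linear maps `π d`, the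
projections onto the pieces, which are jointly compatible with the pieces, and the pieces span. -/
theorem isInternal_of_proj (𝒜 : ℕ → Submodule R A) (π : ℕ → A →ₗ[R] A)
    (h1 : ∀ d, ∀ a ∈ 𝒜 d, π d a = a) (h2 : ∀ d e, d ≠ e → ∀ a ∈ 𝒜 d, π e a = 0)
    (h3 : ∀ a : A, a ∈ ⨆ d, 𝒜 d) : DirectSum.IsInternal 𝒜 := by
  classical
  rw [DirectSum.isInternal_submodule_iff_iSupIndep_and_iSup_eq_top]
  refine ⟨?_, eq_top_iff.2 fun a _ => h3 a⟩
  intro d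
  rw [Submodule.disjoint_def]
  intro a ha hb
  have : (⨆ (j : ℕ) (_ : j ≠ d), 𝒜 j) ≤ LinearMap.ker (π d) :=
    iSup₂_le fun j hj b hb => h2 j d hj b hb
  rw [← h1 d a ha]
  exact this hb

/-- The degree `d` piece of the quotient of a graded algebra by an ideal. -/
def quotGrading (𝒜 : ℕ → Submodule R A) (J : Ideal A) (d : ℕ) : Submodule R (A ⧸ J) :=
  (𝒜 d).map (Ideal.Quotient.mkₐ R J).toLinearMap

/-- The quotient of a graded algebra by a homogeneous ideal is graded. -/
instance quotGradedAlgebra (𝒜 : ℕ → Submodule R A) [GradedAlgebra 𝒜] (J : HomogeneousIdeal 𝒜) :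
    GradedAlgebra (quotGrading 𝒜 J.toIdeal) :=
  gradedOfIsInternal _
    { one_mem := ⟨1, SetLike.GradedOne.one_mem, map_one (Ideal.Quotient.mkₐ R J.toIdeal)⟩
      mul_mem := by
        rintro i j _ _ ⟨a, ha, rfl⟩ ⟨b, hb, rfl⟩
        exact ⟨a * b, SetLike.mul_mem_graded ha hb, map_mul (Ideal.Quotient.mkₐ R J.toIdeal) a b⟩ }
    (by
      classical
      let π : ℕ → (A ⧸ J.toIdeal) →ₗ[R] (A ⧸ J.toIdeal) := fun d =>
        Submodule.mapQ (J.toIdeal.restrictScalars R) (J.toIdeal.restrictScalars R)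
          (GradedAlgebra.proj 𝒜 d) (fun a ha => J.isHomogeneous d ha)
      have hπ : ∀ d a, π d (Ideal.Quotient.mk J.toIdeal a) =
          Ideal.Quotient.mk J.toIdeal (DirectSum.decompose 𝒜 a d) := fun d a => rfl
      refine isInternal_of_proj _ π ?_ ?_ ?_
      · rintro d _ ⟨a, ha, rfl⟩
        refine (hπ d a).trans ?_
        rw [DirectSum.decompose_of_mem_same 𝒜 ha]
        rfl
      · rintro d e hde _ ⟨a, ha, rfl⟩
        refine (hπ e a).trans ?_
        rw [DirectSum.decompose_of_mem_ne 𝒜 ha hde, map_zero]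
      · intro a
        obtain ⟨a, rfl⟩ := Ideal.Quotient.mk_surjective a
        rw [← DirectSum.sum_support_decompose 𝒜 a, map_sum]
        exact Submodule.sum_mem _ fun d _ =>
          Submodule.mem_iSup_of_mem d ⟨_, SetLike.coe_mem _, rfl⟩)

/-- The structure morphism `Proj A ⟶ Spec R` of a graded `R`-algebra `A`. -/
def projToSpec (𝒜 : ℕ → Submodule R A) [GradedAlgebra 𝒜] : Proj 𝒜 ⟶ Spec (.of R) :=
  Proj.toSpecZero 𝒜 ≫ Spec.map (CommRingCat.ofHom (algebraMap R (𝒜 0)))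

end Gradings

section Rees

variable {R : Type u} [CommRing R] (I : Ideal R)

/-- The degree `d` piece `I ^ d t ^ d` of the Rees algebra `⨁ I ^ d t ^ d ⊆ R[t]`. -/
def reesGrading (d : ℕ) : Submodule R (reesAlgebra I) where
  carrier := {p | ∀ i, i ≠ d → (p : Polynomial R).coeff i = 0}
  zero_mem' := fun i _ => by simp
  add_mem' := fun {p q} hp hq i hi => by simp [hp i hi, hq i hi]
  smul_mem' := fun r p hp i hi => by simp [hp i hi]

/-- The element `a t ^ d` of the Rees algebra, for `a ∈ I ^ d`. -/
def reesMonomial (d : ℕ) (a : R) (ha : a ∈ I ^ d) : reesAlgebra I :=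
  ⟨Polynomial.monomial d a, reesAlgebra.monomial_mem.2 ha⟩

/-- The homogeneous component of degree `d` in the Rees algebra. -/
def reesProj (d : ℕ) : reesAlgebra I →ₗ[R] reesAlgebra I where
  toFun p := reesMonomial I d ((p : Polynomial R).coeff d) (p.2 d)
  map_add' p q := Subtype.ext (by simp [reesMonomial])
  map_smul' r p := Subtype.ext (by simp [reesMonomial, Polynomial.smul_monomial])

theorem reesProj_mem (d : ℕ) (p : reesAlgebra I) : reesProj I d p ∈ reesGrading I d :=
  fun i hi => by simp [reesProj, reesMonomial, Polynomial.coeff_monomial, hi.symm]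

theorem reesProj_of_mem (d : ℕ) (p : reesAlgebra I) (hp : p ∈ reesGrading I d) :
    reesProj I d p = p := by
  apply Subtype.ext
  ext i
  by_cases hi : d = i
  · subst hi; simp [reesProj, reesMonomial]
  · simp [reesProj, reesMonomial, Polynomial.coeff_monomial, hi, hp i (Ne.symm hi)]

instance reesGradedAlgebra : GradedAlgebra (reesGrading I) :=
  gradedOfIsInternal _
    { one_mem := fun i hi => by
        simp [Polynomial.coeff_one, hi]
      mul_mem := by
        intro i j p q hp hq l hl
        change ((p : Polynomial R) * (q : Polynomial R)).coeff l = 0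
        rw [Polynomial.coeff_mul]
        refine Finset.sum_eq_zero fun x hx => ?_
        by_cases h : x.1 = i
        · rw [hq x.2 (fun h' => hl (by rw [← Finset.HasAntidiagonal.mem_antidiagonal.1 hx, h, h'])), mul_zero]
        · rw [hp x.1 h, zero_mul] }
    (by
      refine isInternal_of_proj _ (reesProj I) (reesProj_of_mem I) ?_ ?_
      · intro d e hde p hp
        apply Subtype.ext
        simp [reesProj, reesMonomial, hp e hde.symm]
      · intro p
        have : p = ∑ d ∈ (p : Polynomial R).support, reesProj I d p := by
          apply Subtype.ext
          rw [AddSubmonoidClass.coe_finsetSum]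
          exact (p : Polynomial R).as_sum_support
        rw [this]
        exact Submodule.sum_mem _ fun d _ => Submodule.mem_iSup_of_mem d (reesProj_mem I d p))

/-- The blowing up `Proj (⨁ I ^ d)` of `Spec R` along the closed subscheme defined by `I`. -/
def blowup : Scheme.{u} := Proj (reesGrading I)

/-- The blow-down morphism. -/
def blowupMap : blowup I ⟶ Spec (.of R) := projToSpec (reesGrading I)

variable (𝔪 : Ideal R)

/-- The homogeneous ideal `⨁ I ^ d 𝔪` of the Rees algebra `⨁ I ^ d`. -/
def reesMulIdeal : HomogeneousIdeal (reesGrading I) where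
  toSubmodule :=
    { carrier := {p | ∀ d, (p : Polynomial R).coeff d ∈ I ^ d * 𝔪}
      zero_mem' := fun d => by simp
      add_mem' := fun {p q} hp hq d => by
        simpa using Ideal.add_mem _ (hp d) (hq d)
      smul_mem' := fun p q hq d => by
        change ((p : Polynomial R) * (q : Polynomial R)).coeff d ∈ _
        rw [Polynomial.coeff_mul]
        refine Ideal.sum_mem _ fun x hx => ?_
        rw [← Finset.HasAntidiagonal.mem_antidiagonal.1 hx, pow_add, mul_assoc]
        exact Ideal.mul_mem_mul (p.2 x.1) (hq x.2) }
  is_homogeneous' := by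
    intro d p hp
    have key : ((DirectSum.decompose (reesGrading I) p d : reesAlgebra I)) = reesProj I d p := by
      classical
      conv_rhs => rw [← DirectSum.sum_support_decompose (reesGrading I) p, map_sum]
      have h : ∀ e, reesProj I d (DirectSum.decompose (reesGrading I) p e : reesAlgebra I) =
          if e = d then (DirectSum.decompose (reesGrading I) p e : reesAlgebra I) else 0 := by
        intro e
        split_ifs with h
        · subst h; exact reesProj_of_mem I e _ (SetLike.coe_mem _)
        · apply Subtype.ext
          have h0 : ((DirectSum.decompose (reesGrading I) p e : reesAlgebra I) :
              Polynomial R).coeff d = 0 :=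
            (SetLike.coe_mem (DirectSum.decompose (reesGrading I) p e)) d (Ne.symm h)
          simp [reesProj, reesMonomial, h0]
      simp only [h, Finset.sum_ite_eq', DFinsupp.mem_support_toFun]
      split_ifs with h'
      · rfl
      · rw [not_not] at h'
        rw [h']; rfl
    rw [key]
    intro e
    by_cases he : d = e
    · subst he; simpa [reesProj, reesMonomial] using hp d
    · simp [reesProj, reesMonomial, Polynomial.coeff_monomial, he]

/-- The ring `⨁ I ^ d / I ^ d 𝔪`. -/
abbrev FiberRing : Type u := reesAlgebra I ⧸ (reesMulIdeal I 𝔪).toIdeal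

/-- The grading of `⨁ I ^ d / I ^ d 𝔪`, with degree `d` piece `I ^ d / I ^ d 𝔪`. -/
abbrev fiberGrading : ℕ → Submodule R (FiberRing I 𝔪) :=
  quotGrading (reesGrading I) (reesMulIdeal I 𝔪).toIdeal

/-- The structure morphism `Proj (⨁ I ^ d / I ^ d 𝔪) ⟶ Spec R`. -/
abbrev fiberProjToSpec : Proj (fiberGrading I 𝔪) ⟶ Spec (.of R) :=
  projToSpec (A := FiberRing I 𝔪) (fiberGrading I 𝔪)

end Rees

/-- The exceptional locus of a morphism: the points at which it is not a local isomorphism. -/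
def exceptionalLocus {X Y : Scheme.{u}} (f : X ⟶ Y) : Set X :=
  {x | ¬ ∃ U : X.Opens, x ∈ U ∧ IsOpenImmersion (U.ι ≫ f)}

section Classical

attribute [local instance] MvPolynomial.gradedAlgebra

variable {k : Type u} [Field k]

/-- Zariski closed subsets of projective space. -/
def IsProjAlgebraicSet {ι : Type} (V : Set (ℙ k (ι → k))) : Prop :=
  ∃ S : Set (MvPolynomial ι k), (∀ g ∈ S, ∃ d : ℕ, g.IsHomogeneous d) ∧
    V = {p | ∀ g ∈ S, MvPolynomial.eval p.rep g = 0}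

/-- The homogeneous ideal `I(V)` of a subset of projective space, generated by the homogeneous
polynomials that vanish on `V`. -/
def projIdeal {ι : Type} (V : Set (ℙ k (ι → k))) :
    HomogeneousIdeal (MvPolynomial.homogeneousSubmodule ι k) :=
  ⟨Ideal.span {g | (∃ d : ℕ, g.IsHomogeneous d) ∧ ∀ p ∈ V, MvPolynomial.eval p.rep g = 0},
    Ideal.homogeneous_span _ _ fun _ hg => hg.1⟩

/-- The homogeneous coordinate ring `k[x] / I(V)`. -/
abbrev ProjCoordRing {ι : Type} (V : Set (ℙ k (ι → k))) : Type u :=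
  MvPolynomial ι k ⧸ (projIdeal V).toIdeal

/-- The grading of the homogeneous coordinate ring by degree. -/
abbrev projCoordGrading {ι : Type} (V : Set (ℙ k (ι → k))) : ℕ → Submodule k (ProjCoordRing V) :=
  quotGrading (MvPolynomial.homogeneousSubmodule ι k) (projIdeal V).toIdeal

/-- The structure morphism `Proj (k[x] / I(V)) ⟶ Spec k` of a projective variety `V`, regarded as
a scheme over `k`. -/
abbrev projStr {ι : Type} (V : Set (ℙ k (ι → k))) :
    Proj (projCoordGrading V) ⟶ Spec (.of k) :=
  projToSpec (A := ProjCoordRing V) (projCoordGrading V)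

/-- `V` is a smooth projective variety in projective space: a Zariski closed, irreducible subset
such that the associated scheme is smooth over `k`. -/
structure IsSmoothProjVariety {ι : Type} (V : Set (ℙ k (ι → k))) : Prop where
  isAlgebraic : IsProjAlgebraicSet V
  nonempty : V.Nonempty
  irreducible : ∀ A B : Set (ℙ k (ι → k)), IsProjAlgebraicSet A → IsProjAlgebraicSet B →
    V ⊆ A ∪ B → V ⊆ A ∨ V ⊆ B
  smooth : Smooth (projStr V)

/-- Hyperplanes in projective space. -/
def IsHyperplane {ι : Type} (H : Set (ℙ k (ι → k))) : Prop :=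
  ∃ l : (ι → k) →ₗ[k] k, l ≠ 0 ∧ H = {q | l q.rep = 0}

/-- The Segre map `([x], [y]) ↦ [x_i y_j]`. -/
def segre {ι κ : Type} (p : ℙ k (ι → k)) (q : ℙ k (κ → k)) : ℙ k (ι × κ → k) :=
  Projectivization.mk k (fun ij => p.rep ij.1 * q.rep ij.2) (by
    obtain ⟨i, hi⟩ := Function.ne_iff.1 p.rep_nonzero
    obtain ⟨j, hj⟩ := Function.ne_iff.1 q.rep_nonzero
    exact Function.ne_iff.2 ⟨(i, j), mul_ne_zero hi hj⟩)

/-- The product `V × W`, embedded in projective space by the Segre map. -/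
def segreProd {ι κ : Type} (V : Set (ℙ k (ι → k))) (W : Set (ℙ k (κ → k))) :
    Set (ℙ k (ι × κ → k)) :=
  Set.image2 segre V W

/-- The affine cone `C(T)`: the origin together with the nonzero vectors that represent points
of `T`. In particular `C(∅)` is the origin. -/
def cone {ι : Type} (T : Set (ℙ k (ι → k))) : Set (ι → k) :=
  {z | ∀ hz : z ≠ 0, Projectivization.mk k z hz ∈ T}

theorem zero_mem_cone {ι : Type} (T : Set (ℙ k (ι → k))) : (0 : ι → k) ∈ cone T :=
  fun h => absurd rfl h

/-- The affine coordinate ring `k[Y] = k[z] / I(Y)` of a closed subset `Y` of affine space. -/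
abbrev AffCoordRing {ι : Type} (Y : Set (ι → k)) : Type u :=
  MvPolynomial ι k ⧸ MvPolynomial.vanishingIdeal k Y

/-- The ideal in `k[Y]` of a closed subset `Z ⊆ Y`. -/
def idealIn {ι : Type} (Y Z : Set (ι → k)) : Ideal (AffCoordRing Y) :=
  (MvPolynomial.vanishingIdeal k Z).map (Ideal.Quotient.mk (MvPolynomial.vanishingIdeal k Y))

/-- The structure morphism `Spec k[Y] ⟶ Spec k`. -/
abbrev affStr {ι : Type} (Y : Set (ι → k)) : Spec (.of (AffCoordRing Y)) ⟶ Spec (.of k) :=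
  Spec.map (CommRingCat.ofHom (algebraMap k (AffCoordRing Y)))

theorem idealIn_singleton_isMaximal {ι : Type} (Y : Set (ι → k)) (y : ι → k) (hy : y ∈ Y) :
    (idealIn Y {y}).IsMaximal := by
  have hle : MvPolynomial.vanishingIdeal k Y ≤ MvPolynomial.vanishingIdeal k {y} :=
    MvPolynomial.vanishingIdeal_anti_mono (by simpa using hy)
  refine (Ideal.map_eq_top_or_isMaximal_of_surjective _ Ideal.Quotient.mk_surjective
    inferInstance).resolve_left fun h => ?_
  have h1 := congrArg (Ideal.comap (Ideal.Quotient.mk (MvPolynomial.vanishingIdeal k Y))) h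
  rw [Ideal.comap_top, Ideal.comap_map_of_surjective _ Ideal.Quotient.mk_surjective] at h1
  rw [← RingHom.ker_eq_comap_bot, Ideal.mk_ker, sup_eq_left.2 hle] at h1
  exact (inferInstance : (MvPolynomial.vanishingIdeal k {y}).IsMaximal).ne_top h1

/-- The closed point of `Spec k[Y]` given by `y ∈ Y`. -/
def closedPt {ι : Type} (Y : Set (ι → k)) (y : ι → k) (hy : y ∈ Y) :
    Spec (.of (AffCoordRing Y)) :=
  (⟨idealIn Y {y}, (idealIn_singleton_isMaximal Y y hy).isPrime⟩ : PrimeSpectrum (AffCoordRing Y))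

/-- The open subscheme `Y \ {y}`. -/
def complPt {ι : Type} (Y : Set (ι → k)) (y : ι → k) (hy : y ∈ Y) :
    (Spec (.of (AffCoordRing Y))).Opens :=
  ⟨{closedPt Y y hy}ᶜ, by
    rw [isOpen_compl_iff]
    exact (PrimeSpectrum.isClosed_singleton_iff_isMaximal _).2
      (idealIn_singleton_isMaximal Y y hy)⟩

/-- Given new homogeneous coordinates `y'_j = ∑ A_{jl} y_l` on the second factor, the class in
`k[Y]` of the new Segre coordinate `z'_{ij} = ∑ A_{jl} z_{il}`, which restricts to `x_i y'_j`. -/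
def segreCoord {ι κ : Type} [Fintype κ] (Y : Set (ι × κ → k)) (A : Matrix κ κ k)
    (i : ι) (j : κ) : AffCoordRing Y :=
  Ideal.Quotient.mk _ (∑ l, MvPolynomial.C (A j l) * MvPolynomial.X (i, l))

section Setup

variable {n m : ℕ}

/-- The cone `Y = C(V × ℙ^m)`, in the affine space with coordinates `z_{ij}`. -/
abbrev coneY (m : ℕ) (V : Set (ℙ k (Fin (n + 1) → k))) : Set (Fin (n + 1) × Fin (m + 1) → k) :=
  cone (segreProd V Set.univ)

/-- The subcone `Z = C(V × H)` of `Y`. -/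
abbrev coneZ (V : Set (ℙ k (Fin (n + 1) → k))) (H : Set (ℙ k (Fin (m + 1) → k))) :
    Set (Fin (n + 1) × Fin (m + 1) → k) :=
  cone (segreProd V H)

/-- The vertex of `Y`, as a point of the scheme `Spec k[Y]`. -/
abbrev vertex (m : ℕ) (V : Set (ℙ k (Fin (n + 1) → k))) : Spec (.of (AffCoordRing (coneY m V))) :=
  closedPt (coneY m V) 0 (zero_mem_cone _)

/-- The open subscheme `Y \ {v}`, the complement of the vertex. -/
abbrev complVertex (m : ℕ) (V : Set (ℙ k (Fin (n + 1) → k))) :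
    (Spec (.of (AffCoordRing (coneY m V)))).Opens :=
  complPt (coneY m V) 0 (zero_mem_cone _)

/-- The maximal ideal `𝔪_v ⊆ k[Y]` of the vertex. -/
abbrev vertexIdeal (m : ℕ) (V : Set (ℙ k (Fin (n + 1) → k))) : Ideal (AffCoordRing (coneY m V)) :=
  idealIn (coneY m V) {0}

/-- The ideal `I ⊆ k[Y]` of `Z`. -/
abbrev centerIdeal (V : Set (ℙ k (Fin (n + 1) → k))) (H : Set (ℙ k (Fin (m + 1) → k))) :
    Ideal (AffCoordRing (coneY m V)) :=
  idealIn (coneY m V) (coneZ V H)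

/-- The blowing up `f : X ⟶ Y` of `Y` along `Z`. -/
abbrev coneBlowupMap (V : Set (ℙ k (Fin (n + 1) → k))) (H : Set (ℙ k (Fin (m + 1) → k))) :
    blowup (centerIdeal V H) ⟶ Spec (.of (AffCoordRing (coneY m V))) :=
  blowupMap (centerIdeal V H)

end Setup

end Classical

end

end ConeBlowup

open ConeBlowup

namespace ConeBlowup

noncomputable section

open HomogeneousLocalization Limits Graded
open scoped HomogeneousIdeal

section ProjFunctoriality

/-- The structure map `R → (A_s)₀` of a chart of `Proj A`, for a graded `R`-algebra `A`. -/
def toAway {R A : Type u} [CommRing R] [CommRing A] [Algebra R A] (𝒜 : ℕ → Submodule R A)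
    [GradedAlgebra 𝒜] (s : A) : R →+* Away 𝒜 s :=
  (fromZeroRingHom 𝒜 (Submonoid.powers s)).comp (algebraMap R (𝒜 0))

variable {R A : Type u} [CommRing R] [CommRing A] [Algebra R A] (𝒜 : ℕ → Submodule R A)
  [GradedAlgebra 𝒜]

theorem val_toAway (s : A) (r : R) :
    (toAway 𝒜 s r).val = algebraMap A (Localization.Away s) (algebraMap R A r) := by
  rw [← Localization.mk_one_eq_algebraMap]
  rfl

theorem awayι_projToSpec {i : ℕ} (s : A) (hs : s ∈ 𝒜 i) (hi : 0 < i) :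
    Proj.awayι 𝒜 s hs hi ≫ projToSpec 𝒜 = Spec.map (CommRingCat.ofHom (toAway 𝒜 s)) := by
  rw [projToSpec, Proj.awayι_toSpecZero_assoc, ← Spec.map_comp]
  rfl

variable {K B : Type u} [CommRing K] [CommRing B] [Algebra K B] {ℬ : ℕ → Submodule K B}
  [GradedAlgebra ℬ]
variable {𝒜} (f : 𝒜 →+*ᵍ ℬ) (ρ : R →+* K)

theorem irrelevant_le_map_of_surjective (hf : Function.Surjective f) : ℬ₊ ≤ 𝒜₊.map f := by
  classical
  intro b hb
  obtain ⟨a, rfl⟩ := hf b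
  have h0 : f (DirectSum.decompose 𝒜 a 0 : A) = 0 := by
    rw [GradedRingHom.map_directSumDecompose]
    exact hb
  have h1 : f a = f (a - (DirectSum.decompose 𝒜 a 0 : A)) := by rw [map_sub, h0, sub_zero]
  rw [h1]
  refine Ideal.mem_map_of_mem (f : A →+* B) ?_
  change _ ∈ 𝒜₊
  rw [HomogeneousIdeal.mem_irrelevant_iff, GradedRing.proj_apply, DirectSum.decompose_sub,
    DirectSum.decompose_coe]
  simp

variable (hρ : ∀ r, f (algebraMap R A r) = algebraMap K B (ρ r))

include hρ in
theorem awayMap_comp_toAway (s : A) :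
    (Away.map f s).comp (toAway 𝒜 s) = (toAway ℬ (f s)).comp ρ := by
  ext r
  rw [RingHom.comp_apply, RingHom.comp_apply, val_toAway, ← hρ,
    ← Localization.mk_one_eq_algebraMap]
  change Localization.mk (f (algebraMap R A r)) ⟨f 1, _⟩ = _
  congr 1
  exact Subtype.ext (map_one f)

include hρ in
theorem awayι_projMap_projToSpec (hf : ℬ₊ ≤ 𝒜₊.map f) {i : ℕ} (s : A) (hs : s ∈ 𝒜 i)
    (hi : 0 < i) :
    Proj.awayι ℬ (f s) (map_mem f hs) hi ≫ Proj.map f hf ≫ projToSpec 𝒜 =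
      Proj.awayι ℬ (f s) (map_mem f hs) hi ≫ projToSpec ℬ ≫ Spec.map (CommRingCat.ofHom ρ) := by
  rw [Proj.awayι_comp_map_assoc _ _ _ _ hs, awayι_projToSpec, ← Category.assoc,
    awayι_projToSpec, ← Spec.map_comp, ← Spec.map_comp, ← CommRingCat.ofHom_comp,
    ← CommRingCat.ofHom_comp, awayMap_comp_toAway f ρ hρ]

include hρ in
theorem projMap_projToSpec (hf : ℬ₊ ≤ 𝒜₊.map f) :
    Proj.map f hf ≫ projToSpec 𝒜 = projToSpec ℬ ≫ Spec.map (CommRingCat.ofHom ρ) :=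
  (Proj.mapAffineOpenCover f hf).openCover.hom_ext _ _ fun s ↦
    awayι_projMap_projToSpec f ρ hρ hf _ s.2.2 s.1.2

/-- An isomorphism of graded rings induces an isomorphism of homogeneous spectra. -/
def projIsoOfEquiv (e : A ≃+* B) (he : ∀ d a, a ∈ 𝒜 d ↔ e a ∈ ℬ d) : Proj 𝒜 ≅ Proj ℬ :=
  let f : 𝒜 →+*ᵍ ℬ := ⟨e, fun {d a} h => (he d a).1 h⟩
  let g : ℬ →+*ᵍ 𝒜 := ⟨e.symm, fun {d b} h => (he d _).2 (by simpa using h)⟩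
  have hf : ℬ₊ ≤ 𝒜₊.map f := irrelevant_le_map_of_surjective f e.surjective
  have hg : 𝒜₊ ≤ ℬ₊.map g := irrelevant_le_map_of_surjective g e.symm.surjective
  have hgf : g.comp f = .id 𝒜 := GradedRingHom.ext fun a => e.symm_apply_apply a
  have hfg : f.comp g = .id ℬ := GradedRingHom.ext fun a => e.apply_symm_apply a
  { hom := Proj.map g hg
    inv := Proj.map f hf
    hom_inv_id := by
      rw [← Proj.map_comp, ← Proj.map_id]
      congr 1
    inv_hom_id := by
      rw [← Proj.map_comp, ← Proj.map_id]
      congr 1 }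

theorem projIsoOfEquiv_inv_projToSpec (e : A ≃+* B) (he : ∀ d a, a ∈ 𝒜 d ↔ e a ∈ ℬ d)
    (hρ : ∀ r, e (algebraMap R A r) = algebraMap K B (ρ r)) :
    (projIsoOfEquiv e he).inv ≫ projToSpec 𝒜 =
      projToSpec ℬ ≫ Spec.map (CommRingCat.ofHom ρ) :=
  projMap_projToSpec _ ρ hρ _

/-- The square of rings obtained from a surjection `R → K` and a surjection `B → C` whose kernel is
generated by the kernel of `R → K` is a pushout. -/
theorem isPushout_of_surjective {R K B C : Type u} [CommRing R] [CommRing K] [CommRing B]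
    [CommRing C] (ρ : R →+* K) (g : R →+* B) (p : B →+* C) (q : K →+* C)
    (hρ : Function.Surjective ρ) (hp : Function.Surjective p) (w : p.comp g = q.comp ρ)
    (hker : RingHom.ker p ≤ (RingHom.ker ρ).map g) :
    IsPushout (CommRingCat.ofHom g) (CommRingCat.ofHom ρ) (CommRingCat.ofHom p)
      (CommRingCat.ofHom q) := by
  refine ⟨⟨by rw [← CommRingCat.ofHom_comp, ← CommRingCat.ofHom_comp, w]⟩,
    ⟨PushoutCocone.IsColimit.mk _ (fun s => CommRingCat.ofHom
      (RingHom.liftOfSurjective p hp ⟨s.inl.hom, hker.trans ?_⟩)) ?_ ?_ ?_⟩⟩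
  · rw [Ideal.map_le_iff_le_comap]
    intro r hr
    have h := congrArg (fun φ => φ.hom r) s.condition
    simp only [CommRingCat.hom_comp, CommRingCat.hom_ofHom, RingHom.comp_apply] at h
    rw [Ideal.mem_comap, RingHom.mem_ker]
    erw [h, (RingHom.mem_ker).1 hr, map_zero]
  · intro s
    ext b
    exact RingHom.liftOfRightInverse_comp_apply p _ (Function.rightInverse_surjInv hp) _ b
  · intro s
    ext c
    obtain ⟨r, rfl⟩ := hρ c
    have h := congrArg (fun φ => φ.hom r) s.condition
    simp only [CommRingCat.hom_comp, CommRingCat.hom_ofHom, RingHom.comp_apply] at h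
    have h' := RingHom.congr_fun w r
    simp only [RingHom.comp_apply] at h'
    simp only [CommRingCat.hom_comp, CommRingCat.hom_ofHom, RingHom.comp_apply, ← h']
    rw [← h]
    exact RingHom.liftOfRightInverse_comp_apply p _ (Function.rightInverse_surjInv hp) _ _
  · intro s m h1 h2
    ext c
    obtain ⟨b, rfl⟩ := hp c
    refine Eq.trans ?_ (RingHom.liftOfRightInverse_comp_apply p _
      (Function.rightInverse_surjInv hp) _ b).symm
    exact congrArg (fun φ => φ.hom b) h1

theorem awayMap_surjective {i : ℕ} (s : A) (hs : s ∈ 𝒜 i) (hf : Function.Surjective f) :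
    Function.Surjective (Away.map f s) := by
  classical
  intro z
  obtain ⟨n, b, hb, rfl⟩ := Away.mk_surjective ℬ (map_mem f hs) z
  obtain ⟨a, rfl⟩ := hf b
  refine ⟨Away.mk 𝒜 hs n _ (SetLike.coe_mem (DirectSum.decompose 𝒜 a (n • i))), ?_⟩
  rw [Away.map_mk]
  congr 1
  rw [GradedRingHom.map_directSumDecompose, DirectSum.decompose_of_mem_same _ hb]

theorem ker_awayMap_le {i : ℕ} (s : A) (hs : s ∈ 𝒜 i)
    (hker : ∀ d, ∀ a ∈ 𝒜 d, f a = 0 → a ∈ RingHom.ker ρ • 𝒜 d) :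
    RingHom.ker (Away.map f s) ≤ (RingHom.ker ρ).map (toAway 𝒜 s) := by
  intro z hz
  obtain ⟨n, a, ha, rfl⟩ := Away.mk_surjective 𝒜 hs z
  rw [RingHom.mem_ker, Away.map_mk, HomogeneousLocalization.ext_iff_val, Away.val_mk, val_zero,
    Localization.mk_eq_mk', IsLocalization.mk'_eq_zero_iff] at hz
  obtain ⟨⟨_, N, rfl⟩, hN⟩ := hz
  have hmem : s ^ N * a ∈ RingHom.ker ρ • 𝒜 ((N + n) • i) := by
    refine hker _ _ ?_ (by simpa using hN)
    rw [add_smul]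
    exact SetLike.mul_mem_graded (SetLike.pow_mem_graded N hs) ha
  have key : ∀ x, x ∈ RingHom.ker ρ • 𝒜 ((N + n) • i) → ∃ hx : x ∈ 𝒜 ((N + n) • i),
      Away.mk 𝒜 hs (N + n) x hx ∈ (RingHom.ker ρ).map (toAway 𝒜 s) := by
    intro x hx
    induction hx using Submodule.smul_induction_on' with
    | smul r hr y hy =>
      refine ⟨Submodule.smul_mem _ r hy, ?_⟩
      have : Away.mk 𝒜 hs (N + n) (r • y) (Submodule.smul_mem _ r hy) =
          toAway 𝒜 s r * Away.mk 𝒜 hs (N + n) y hy := by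
        ext
        rw [val_mul, val_toAway, Away.val_mk, Away.val_mk, ← Localization.mk_one_eq_algebraMap,
          Localization.mk_mul, one_mul, Algebra.smul_def]
      rw [this]
      exact Ideal.mul_mem_right _ _ (Ideal.mem_map_of_mem _ hr)
    | add x hx y hy ihx ihy =>
      obtain ⟨hx, ihx⟩ := ihx
      obtain ⟨hy, ihy⟩ := ihy
      refine ⟨add_mem hx hy, ?_⟩
      have : Away.mk 𝒜 hs (N + n) (x + y) (add_mem hx hy) =
          Away.mk 𝒜 hs (N + n) x hx + Away.mk 𝒜 hs (N + n) y hy := by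
        ext
        rw [val_add, Away.val_mk, Away.val_mk, Away.val_mk, Localization.add_mk_self]
      rw [this]
      exact Ideal.add_mem _ ihx ihy
  obtain ⟨hx, h⟩ := key _ hmem
  convert h using 1
  ext
  rw [Away.val_mk, Away.val_mk, Localization.mk_eq_mk_iff, Localization.r_iff_exists]
  exact ⟨1, by simp; ring⟩

include hρ in
theorem isPullback_projMap_chart (hf : Function.Surjective f) (hf' : ℬ₊ ≤ 𝒜₊.map f)
    (hρs : Function.Surjective ρ)
    (hker : ∀ d, ∀ a ∈ 𝒜 d, f a = 0 → a ∈ RingHom.ker ρ • 𝒜 d) {i : ℕ} (s : A) (hs : s ∈ 𝒜 i)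
    (hi : 0 < i) :
    IsPullback (pullback.snd (Proj.map f hf') (Proj.awayι 𝒜 s hs hi))
      (pullback.fst (Proj.map f hf') (Proj.awayι 𝒜 s hs hi) ≫ projToSpec ℬ)
      (Proj.awayι 𝒜 s hs hi ≫ projToSpec 𝒜) (Spec.map (CommRingCat.ofHom ρ)) := by
  have h1 : IsPullback (Spec.map (CommRingCat.ofHom (Away.map f s)))
      (Proj.awayι ℬ (f s) (map_mem f hs) hi) (Proj.awayι 𝒜 s hs hi) (Proj.map f hf') := by
    refine IsOpenImmersion.isPullback _ _ _ _ (Proj.awayι_comp_map f hf' hi _ hs) ?_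
    rw [Proj.opensRange_awayι, Proj.opensRange_awayι, Proj.map_preimage_basicOpen]
  have h2 := isPullback_SpecMap_of_isPushout _ _ _ _
    (isPushout_of_surjective ρ (toAway 𝒜 s) (Away.map f s) (toAway ℬ (f s)) hρs
      (awayMap_surjective f _ hs hf) (awayMap_comp_toAway f ρ hρ _)
      (ker_awayMap_le f ρ _ hs hker))
  rw [← awayι_projToSpec 𝒜 _ hs hi, ← awayι_projToSpec ℬ _ (map_mem f hs) hi] at h2
  refine IsPullback.of_iso h2 h1.flip.isoPullback (Iso.refl _) (Iso.refl _)
    (Iso.refl _) ?_ ?_ ?_ ?_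
  · simp
  · simp
  · simp
  · simp

include hρ in
/-- Base change of `Proj` along a surjection `R → K`. -/
theorem isPullback_projMap (hf : Function.Surjective f) (hρs : Function.Surjective ρ)
    (hker : ∀ d, ∀ a ∈ 𝒜 d, f a = 0 → a ∈ RingHom.ker ρ • 𝒜 d) :
    IsPullback (Proj.map f (irrelevant_le_map_of_surjective f hf)) (projToSpec ℬ) (projToSpec 𝒜)
      (Spec.map (CommRingCat.ofHom ρ)) :=
  Scheme.isPullback_of_openCover _ _ _ _ (Proj.affineOpenCover 𝒜).openCover fun s ↦
    isPullback_projMap_chart f ρ hρ hf _ hρs hker _ s.2.2 s.1.2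

theorem exists_isPullback_proj (e : A →+* B) (he : ∀ d, ∀ a ∈ 𝒜 d, e a ∈ ℬ d)
    (hρ : ∀ r, e (algebraMap R A r) = algebraMap K B (ρ r)) (hes : Function.Surjective e)
    (hρs : Function.Surjective ρ)
    (hker : ∀ d, ∀ a ∈ 𝒜 d, e a = 0 → a ∈ RingHom.ker ρ • 𝒜 d) :
    ∃ i : Proj ℬ ⟶ Proj 𝒜, IsPullback i (projToSpec ℬ) (projToSpec 𝒜)
      (Spec.map (CommRingCat.ofHom ρ)) :=
  ⟨_, isPullback_projMap (⟨e, fun {d a} h => he d a h⟩ : 𝒜 →+*ᵍ ℬ) ρ hρ hes hρs hker⟩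

end ProjFunctoriality

end

end ConeBlowup

namespace ConeBlowup

noncomputable section

open HomogeneousLocalization Limits Graded
open scoped HomogeneousIdeal

section ProjPoints

variable {R A : Type u} [CommRing R] [CommRing A] [Algebra R A] (𝒜 : ℕ → Submodule R A)
  [GradedAlgebra 𝒜]

theorem exists_homogeneous_notMem (x : Proj 𝒜) :
    ∃ (i : ℕ) (s : A), 0 < i ∧ s ∈ 𝒜 i ∧ s ∉ x.asHomogeneousIdeal := by
  by_contra! h
  exact x.not_irrelevant_le ((HomogeneousIdeal.toIdeal_irrelevant_le _).2 fun i hi s hs => h i s hi hs)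

theorem projToSpec_preimage_basicOpen (r : R) :
    projToSpec 𝒜 ⁻¹ᵁ (PrimeSpectrum.basicOpen r : (Spec (.of R)).Opens) =
      Proj.basicOpen 𝒜 (algebraMap R A r) := by
  ext x
  obtain ⟨i, s, hi, hs, hx⟩ := exists_homogeneous_notMem 𝒜 x
  have hr : algebraMap R A r ∈ 𝒜 0 := SetLike.algebraMap_mem_graded 𝒜 r
  have hsr : s * algebraMap R A r ∈ 𝒜 i := by simpa using SetLike.mul_mem_graded hs hr
  obtain ⟨y, rfl⟩ : x ∈ (Proj.awayι 𝒜 s hs hi).opensRange := by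
    rw [Proj.opensRange_awayι]; exact hx
  have h1 : Proj.awayι 𝒜 s hs hi y ∈ Proj.basicOpen 𝒜 (algebraMap R A r) ↔
      Proj.awayι 𝒜 s hs hi y ∈ Proj.basicOpen 𝒜 (s * algebraMap R A r) := by
    rw [Proj.basicOpen_mul]
    exact ⟨fun h => ⟨hx, h⟩, fun h => h.2⟩
  have h2 : Proj.awayι 𝒜 s hs hi y ∈ Proj.basicOpen 𝒜 (s * algebraMap R A r) ↔
      y ∈ PrimeSpectrum.basicOpen (Away.isLocalizationElem hs hsr) := by
    rw [← Proj.awayι_preimage_basicOpen 𝒜 hs hi hsr hi]; rfl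
  have h3 : Away.isLocalizationElem hs hsr = toAway 𝒜 s r ^ i := by
    ext
    rw [val_pow, val_toAway, Away.val_mk, mul_pow, ← map_pow, ← map_pow,
      ← Localization.mk_one_eq_algebraMap, Localization.mk_eq_mk_iff, Localization.r_iff_exists]
    exact ⟨1, by simp⟩
  have h4 : projToSpec 𝒜 (Proj.awayι 𝒜 s hs hi y) =
      Spec.map (CommRingCat.ofHom (toAway 𝒜 s)) y := by
    rw [← awayι_projToSpec 𝒜 s hs hi]; rfl
  change projToSpec 𝒜 (Proj.awayι 𝒜 s hs hi y) ∈ PrimeSpectrum.basicOpen r ↔ _ ∈ Proj.basicOpen 𝒜 _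
  rw [h1, h2, h3, h4, PrimeSpectrum.basicOpen_pow _ _ hi]
  rfl

end ProjPoints

section Restrict

/-- A morphism is an isomorphism over the union of a family of open subschemes as soon as it is an
isomorphism over each of them. -/
theorem isIso_morphismRestrict_iSup {X Y : Scheme.{u}} (f : X ⟶ Y) {J : Type*} (U : J → Y.Opens)
    (h : ∀ j, IsIso (f ∣_ U j)) : IsIso (f ∣_ ⨆ j, U j) := by
  let 𝒰 := Scheme.Opens.iSupOpenCover U
  refine (IsZariskiLocalAtTarget.iff_of_openCover (P := .isomorphisms _) 𝒰).mpr fun x ↦ ?_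
  refine (MorphismProperty.arrow_mk_iso_iff (.isomorphisms _)
    ((morphismRestrictRestrict ..).symm ≪≫ morphismRestrictOpensRange ..)).mp ?_
  have : Scheme.Opens.ι _ ''ᵁ (𝒰.f x).opensRange = U x := by
    simp only [Scheme.Opens.iSupOpenCover, 𝒰, ← Scheme.Hom.opensRange_comp, Scheme.homOfLE_ι,
      Scheme.Opens.opensRange_ι]
  convert! h x

/-- If an open immersion `j` onto the preimage of `U` is such that `j ≫ f` is an open immersion onto
`U`, then `f` is an isomorphism over `U`. -/
theorem isIso_morphismRestrict_of_chart {W X Y : Scheme.{u}} (f : X ⟶ Y) (j : W ⟶ X)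
    [IsOpenImmersion j] (i : W ⟶ Y) [IsOpenImmersion i] (hij : j ≫ f = i)
    (h : f ⁻¹ᵁ i.opensRange = j.opensRange) : IsIso (f ∣_ i.opensRange) := by
  have hp : IsPullback (𝟙 W) j i f := IsOpenImmersion.isPullback _ _ _ _ (by simpa using hij) h
  refine (MorphismProperty.arrow_mk_iso_iff (.isomorphisms _)
    (morphismRestrictOpensRange f i)).mpr ?_
  have : pullback.snd f i = hp.flip.isoPullback.inv := by
    rw [← hp.flip.isoPullback_inv_snd, Category.comp_id]
  change IsIso (pullback.snd f i)
  rw [this]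
  infer_instance

end Restrict

section Blowup

variable {R : Type u} [CommRing R] (I : Ideal R)

theorem reesMonomial_mem (d : ℕ) (a : R) (ha : a ∈ I ^ d) :
    reesMonomial I d a ha ∈ reesGrading I d :=
  fun i hi => by simp [reesMonomial, Polynomial.coeff_monomial, hi.symm]

theorem mem_reesGrading_iff {d : ℕ} {p : reesAlgebra I} :
    p ∈ reesGrading I d ↔ ∃ a ha, reesMonomial I d a ha = p :=
  ⟨fun h => ⟨_, p.2 d, reesProj_of_mem I d p h⟩, by rintro ⟨a, ha, rfl⟩; exact reesMonomial_mem I d a ha⟩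

theorem reesMonomial_mul (d e : ℕ) (a b : R) (ha : a ∈ I ^ d) (hb : b ∈ I ^ e) :
    reesMonomial I d a ha * reesMonomial I e b hb =
      reesMonomial I (d + e) (a * b) (by rw [pow_add]; exact Ideal.mul_mem_mul ha hb) :=
  Subtype.ext (Polynomial.monomial_mul_monomial _ _ _ _)

theorem algebraMap_mul_reesMonomial (d : ℕ) (r a : R) (ha : a ∈ I ^ d) :
    algebraMap R (reesAlgebra I) r * reesMonomial I d a ha =
      reesMonomial I d (r * a) (Ideal.mul_mem_left _ _ ha) :=
  Subtype.ext (Polynomial.C_mul_monomial)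

theorem reesMonomial_add (d : ℕ) (a b : R) (ha : a ∈ I ^ d) (hb : b ∈ I ^ d) :
    reesMonomial I d (a + b) (add_mem ha hb) = reesMonomial I d a ha + reesMonomial I d b hb :=
  Subtype.ext (map_add _ _ _)

theorem reesMonomial_pow (d n : ℕ) (a : R) (ha : a ∈ I ^ d) :
    reesMonomial I d a ha ^ n =
      reesMonomial I (n * d) (a ^ n) (by rw [mul_comm, pow_mul]; exact Ideal.pow_mem_pow ha n) :=
  Subtype.ext (by simp [reesMonomial, Polynomial.monomial_pow, mul_comm])

theorem reesMonomial_injective {d : ℕ} {a b : R} {ha : a ∈ I ^ d} {hb : b ∈ I ^ d}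
    (h : reesMonomial I d a ha = reesMonomial I d b hb) : a = b :=
  Polynomial.monomial_injective d (congrArg Subtype.val h)

theorem exists_reesMonomial_one_notMem (x : blowup I) :
    ∃ (b : R) (hb : b ∈ I ^ 1), reesMonomial I 1 b hb ∉ x.asHomogeneousIdeal := by
  by_contra! h
  refine x.not_irrelevant_le ((HomogeneousIdeal.toIdeal_irrelevant_le _).2 fun i hi p hp => ?_)
  obtain ⟨a, ha, rfl⟩ := (mem_reesGrading_iff I).1 hp
  obtain ⟨e, rfl⟩ := Nat.exists_eq_succ_of_ne_zero hi.ne'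
  suffices ∃ ha : a ∈ I ^ (e + 1), reesMonomial I (e + 1) a ha ∈ x.asHomogeneousIdeal.toIdeal from
    this.2
  have ha' : a ∈ I ^ e * I ^ 1 := by rwa [← pow_add]
  induction ha' using Submodule.mul_induction_on' with
  | mem_mul_mem b hb c hc =>
    refine ⟨by rw [pow_add]; exact Ideal.mul_mem_mul hb hc, ?_⟩
    rw [← reesMonomial_mul I e 1 b c hb hc]
    exact Ideal.mul_mem_left _ _ (h c hc)
  | add b hb c hc ihb ihc =>
    rw [← pow_add] at hb hc
    obtain ⟨_, ihb⟩ := ihb hb (reesMonomial_mem I _ _ hb)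
    obtain ⟨_, ihc⟩ := ihc hc (reesMonomial_mem I _ _ hc)
    refine ⟨ha, ?_⟩
    rw [reesMonomial_add I _ b c hb hc]
    exact add_mem ihb ihc

variable {I} {s a : R} (ha : a ∈ I) (hs : ∀ b ∈ I, a ∣ s * b)

include hs in
theorem dvd_pow_mul (n : ℕ) : ∀ b ∈ I ^ n, a ^ n ∣ s ^ n * b := by
  induction n with
  | zero => simp
  | succ n ih =>
    intro b hb
    rw [pow_succ] at hb
    induction hb using Submodule.mul_induction_on' with
    | mem_mul_mem b hb c hc =>
      rw [pow_succ, pow_succ, mul_mul_mul_comm]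
      exact mul_dvd_mul (ih b hb) (hs c hc)
    | add b hb c hc ihb ihc =>
      rw [mul_add]
      exact dvd_add ihb ihc

include hs in
/-- Where the ideal is generated by a regular element, a chart of the blowing up is a localization
of the base. -/
theorem isLocalization_toAway (hreg : a ∈ nonZeroDivisors R) (ha1 : a ∈ I ^ 1)
    (hsa : s * a ∈ I ^ 1) :
    letI := (toAway (reesGrading I) (reesMonomial I 1 (s * a) hsa)).toAlgebra
    IsLocalization.Away s (Away (reesGrading I) (reesMonomial I 1 (s * a) hsa)) := by
  set g := reesMonomial I 1 (s * a) hsa with hg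
  have hg1 : g ∈ reesGrading I 1 := reesMonomial_mem I _ _ _
  let := (toAway (reesGrading I) g).toAlgebra
  have hmap : ∀ r, algebraMap R (Away (reesGrading I) g) r = toAway (reesGrading I) g r :=
    fun _ => rfl
  constructor; constructor
  · rintro ⟨_, n, rfl⟩
    rw [map_pow]
    refine IsUnit.pow _ (isUnit_iff_exists_inv.2
      ⟨Away.mk (reesGrading I) hg1 1 (reesMonomial I 1 a ha1) (reesMonomial_mem I _ _ _), ?_⟩)
    ext
    rw [hmap, val_mul, val_toAway, Away.val_mk, val_one, ← Localization.mk_one_eq_algebraMap,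
      Localization.mk_mul, ← Localization.mk_one, Localization.mk_eq_mk_iff,
      Localization.r_iff_exists]
    exact ⟨1, by simp [algebraMap_mul_reesMonomial, hg]⟩
  · intro z
    obtain ⟨n, p, hp, rfl⟩ := Away.mk_surjective (reesGrading I) hg1 z
    obtain ⟨b, hb, rfl⟩ := (mem_reesGrading_iff I).1 hp
    obtain ⟨r, hr⟩ := dvd_pow_mul hs n b (by simpa using hb)
    refine ⟨⟨r, ⟨s ^ (2 * n), 2 * n, rfl⟩⟩, ?_⟩
    ext
    rw [hmap, hmap, val_mul, val_toAway, val_toAway, Away.val_mk,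
      ← Localization.mk_one_eq_algebraMap, ← Localization.mk_one_eq_algebraMap,
      Localization.mk_mul, Localization.mk_eq_mk_iff, Localization.r_iff_exists]
    refine ⟨1, ?_⟩
    have h : s ^ (2 * n) * b = r * (s * a) ^ n := by
      rw [two_mul, pow_add, mul_assoc, hr]; ring
    simp only [OneMemClass.coe_one, one_mul, mul_one]
    rw [mul_comm (reesMonomial I _ _ _), algebraMap_mul_reesMonomial, hg, reesMonomial_pow,
      mul_comm (reesMonomial I _ _ _), algebraMap_mul_reesMonomial]
    refine Subtype.ext ?_
    simp [reesMonomial, h]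
  · intro x y hxy
    have h := congrArg HomogeneousLocalization.val hxy
    rw [hmap, hmap, val_toAway, val_toAway, ← Localization.mk_one_eq_algebraMap,
      ← Localization.mk_one_eq_algebraMap, Localization.mk_eq_mk_iff,
      Localization.r_iff_exists] at h
    obtain ⟨⟨_, N, rfl⟩, h⟩ := h
    simp only [OneMemClass.coe_one, one_mul] at h
    rw [hg, reesMonomial_pow, mul_comm, algebraMap_mul_reesMonomial,
      mul_comm (reesMonomial I _ _ _), algebraMap_mul_reesMonomial] at h
    have h' := reesMonomial_injective I h
    refine ⟨⟨s ^ N, N, rfl⟩, ?_⟩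
    refine (mul_cancel_left_mem_nonZeroDivisors (pow_mem hreg N)).1 ?_
    rw [mul_pow] at h'
    linear_combination h'

include ha hs in
theorem isIso_blowupMap_restrict_basicOpen (hreg : a ∈ nonZeroDivisors R) :
    IsIso (blowupMap I ∣_ (PrimeSpectrum.basicOpen s : (Spec (.of R)).Opens)) := by
  have hsa : s * a ∈ I ^ 1 := by simpa using Ideal.mul_mem_left _ _ ha
  have ha1 : a ∈ I ^ 1 := by simpa using ha
  set g := reesMonomial I 1 (s * a) hsa with hg
  have hg1 : g ∈ reesGrading I 1 := reesMonomial_mem I _ _ _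
  let := (toAway (reesGrading I) g).toAlgebra
  have hloc : IsLocalization.Away s (Away (reesGrading I) g) := isLocalization_toAway hs hreg ha1 hsa
  have hoi : IsOpenImmersion (Spec.map (CommRingCat.ofHom (toAway (reesGrading I) g))) :=
    IsOpenImmersion.of_isLocalization s
  have hrange : (Spec.map (CommRingCat.ofHom (toAway (reesGrading I) g))).opensRange =
      (PrimeSpectrum.basicOpen s : (Spec (.of R)).Opens) :=
    TopologicalSpace.Opens.ext (PrimeSpectrum.localization_away_comap_range (Away (reesGrading I) g) s)
  rw [← hrange]
  refine isIso_morphismRestrict_of_chart _ (Proj.awayι (reesGrading I) g hg1 one_pos) _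
    (awayι_projToSpec _ _ _ _) ?_
  rw [hrange, Proj.opensRange_awayι]
  refine (projToSpec_preimage_basicOpen _ s).trans ?_
  have hg' : g = algebraMap R _ s * reesMonomial I 1 a ha1 :=
    (algebraMap_mul_reesMonomial I 1 s a ha1).symm
  rw [hg', Proj.basicOpen_mul, eq_comm, inf_eq_left]
  intro x hx hxa
  obtain ⟨b, hb, hxb⟩ := exists_reesMonomial_one_notMem I x
  obtain ⟨r, hr⟩ := hs b (by simpa using hb)
  have h1 : algebraMap R (reesAlgebra I) s * reesMonomial I 1 b hb =
      algebraMap R (reesAlgebra I) r * reesMonomial I 1 a ha1 := by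
    rw [algebraMap_mul_reesMonomial, algebraMap_mul_reesMonomial]
    exact Subtype.ext (congrArg (Polynomial.monomial 1) (by rw [hr, mul_comm]))
  have h2 : algebraMap R (reesAlgebra I) s * reesMonomial I 1 b hb ∈
      x.asHomogeneousIdeal.toIdeal := h1 ▸ Ideal.mul_mem_left _ _ hxa
  exact (x.isPrime.mem_or_mem h2).elim hx hxb

end Blowup

end

end ConeBlowup

namespace ConeBlowup

noncomputable section

open HomogeneousLocalization Limits Graded
open scoped HomogeneousIdeal

section Fiber

/-- The fibre over the closed point of an affine scheme given by a surjection onto a field is the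
base change along that surjection. -/
theorem exists_fiber_iso_of_isPullback {R : CommRingCat.{u}} {K : Type u} [Field K]
    {X P : Scheme.{u}} (f : X ⟶ Spec R) (v : Spec R) (ρ : R ⟶ .of K)
    (hρ : Function.Surjective ρ) (hker : RingHom.ker ρ.hom = v.asIdeal) (i : P ⟶ X)
    (c : P ⟶ Spec (.of K)) (h : IsPullback i c f (Spec.map ρ)) :
    ∃ e : f.fiber v ≅ P, e.hom ≫ i = f.fiberι v := by
  have hprime : v.asIdeal.IsPrime := v.isPrime
  have hunit : v.asIdeal.primeCompl ≤ (IsUnit.submonoid K).comap ρ.hom := by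
    intro a ha
    refine IsUnit.mk0 _ fun h0 => ha ?_
    have : a ∈ RingHom.ker ρ.hom := h0
    rwa [hker] at this
  let l : v.asIdeal.ResidueField →+* K := Ideal.ResidueField.lift v.asIdeal ρ.hom hker.ge hunit
  have hl : l.comp (algebraMap R v.asIdeal.ResidueField) = ρ.hom := by
    ext r
    exact Ideal.ResidueField.lift_algebraMap _ _ hker.ge hunit r
  have hbij : Function.Bijective l := by
    refine ⟨l.injective, fun x => ?_⟩
    obtain ⟨r, rfl⟩ := hρ x
    exact ⟨algebraMap R _ r, RingHom.congr_fun hl r⟩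
  let e : CommRingCat.of v.asIdeal.ResidueField ≅ CommRingCat.of K :=
    (RingEquiv.ofBijective l hbij).toCommRingCatIso
  let e' : (Spec R).residueField v ≅ CommRingCat.of K := Scheme.Spec.residueFieldIso R v ≪≫ e
  let w : Spec (.of K) ≅ Spec ((Spec R).residueField v) := Scheme.Spec.mapIso e'.op
  have hw : w.hom ≫ (Spec R).fromSpecResidueField v = Spec.map ρ := by
    rw [← Scheme.Spec.map_residueFieldIso_inv_eq_fromSpecResidueField]
    change Spec.map e'.hom ≫ _ = _
    rw [← Spec.map_comp, ← Spec.map_comp]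
    congr 1
    simp only [e', Iso.trans_hom, Category.assoc, Iso.inv_hom_id_assoc]
    ext r
    exact RingHom.congr_fun hl r
  have h' : IsPullback i (c ≫ w.hom) f ((Spec R).fromSpecResidueField v) :=
    h.of_iso (Iso.refl _) (Iso.refl _) w (Iso.refl _) (by simp) (by simp) (by simp) (by simp [hw])
  exact ⟨h'.isoPullback.symm, h'.isoPullback_inv_fst⟩

end Fiber

section ExceptionalLocus

variable {X Y : Scheme.{u}} (f : X ⟶ Y)

theorem exceptionalLocus_subset_of_isIso (W : Y.Opens) (h : IsIso (f ∣_ W)) :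
    exceptionalLocus f ⊆ f ⁻¹' (W : Set Y)ᶜ := by
  intro x hx hxW
  refine hx ⟨f ⁻¹ᵁ W, hxW, ?_⟩
  rw [← morphismRestrict_ι]
  infer_instance

/-- A connected fibre of finite type with at least two points lies in the exceptional locus. -/
theorem preimage_subset_exceptionalLocus (y : Y) [JacobsonSpace (f.fiber y)]
    [PreconnectedSpace (f.fiber y)] [Nontrivial (f.fiber y)] :
    f ⁻¹' {y} ⊆ exceptionalLocus f := by
  rintro x hx ⟨U, hxU, hU⟩
  obtain ⟨p, rfl⟩ : x ∈ Set.range (f.fiberι y) := by rwa [Scheme.Hom.range_fiberι]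
  have hy : ∀ q : f.fiber y, f (f.fiberι y q) = y := by
    intro q
    have : f.fiberι y q ∈ f ⁻¹' {y} := by
      rw [← Scheme.Hom.range_fiberι]; exact ⟨q, rfl⟩
    exact this
  have hinj : Function.Injective (U.ι ≫ f) := (U.ι ≫ f).isOpenEmbedding.injective
  have hp : (f.fiberι y) ⁻¹' (U : Set X) = {p} := by
    ext q
    refine ⟨fun hq => ?_, fun hq => by rw [hq]; exact hxU⟩
    have h1 : (U.ι ≫ f) ⟨_, hq⟩ = (U.ι ≫ f) ⟨_, hxU⟩ := by
      change f (f.fiberι y q) = f (f.fiberι y p)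
      rw [hy, hy]
    exact (f.fiberι y).isEmbedding.injective (congrArg Subtype.val (hinj h1))
  have hopen : IsOpen ({p} : Set (f.fiber y)) :=
    hp ▸ U.isOpen.preimage (f.fiberι y).continuous
  have hclosed : IsClosed ({p} : Set (f.fiber y)) :=
    isClosed_singleton_of_isLocallyClosed_singleton hopen.isLocallyClosed
  have huniv := IsClopen.eq_univ ⟨hclosed, hopen⟩ (Set.singleton_nonempty p)
  obtain ⟨q, hq⟩ := exists_ne p
  exact hq (by have : q ∈ ({p} : Set (f.fiber y)) := huniv ▸ Set.mem_univ q
               exact this)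

end ExceptionalLocus

section GenericPoint

variable {R A : Type u} [CommRing R] [CommRing A] [Algebra R A] (𝒜 : ℕ → Submodule R A)
  [GradedAlgebra 𝒜] [IsDomain A]

/-- The generic point of `Proj A`, for a graded domain `A` which is not concentrated in degree
zero. -/
def projGenericPoint (h : ∃ a ∈ 𝒜 1, a ≠ 0) : Proj 𝒜 :=
  (⟨⊥, Ideal.isPrime_bot, fun hle => by
    obtain ⟨a, ha, h0⟩ := h
    exact h0 (hle (HomogeneousIdeal.mem_irrelevant_of_mem 𝒜 one_pos ha))⟩ : ProjectiveSpectrum 𝒜)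

theorem preconnectedSpace_proj (h : ∃ a ∈ 𝒜 1, a ≠ 0) : PreconnectedSpace (Proj 𝒜) := by
  have hd : closure {projGenericPoint 𝒜 h} = (Set.univ : Set (Proj 𝒜)) := by
    rw [← dense_iff_closure_eq, (Proj.isBasis_basicOpen 𝒜).dense_iff]
    rintro _ ⟨_, ⟨a, rfl⟩, rfl⟩ ⟨x, hx⟩
    refine ⟨_, fun h0 => hx ?_, rfl⟩
    have : a = 0 := h0
    rw [this]
    exact zero_mem _
  exact ⟨hd ▸ (isIrreducible_singleton.closure).isPreirreducible.isPreconnected⟩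

end GenericPoint

end

end ConeBlowup

namespace ConeBlowup

noncomputable section

section Cones

attribute [local instance] MvPolynomial.gradedAlgebra

variable {k : Type u} [Field k] {ι κ : Type}

theorem smul_mem_cone {T : Set (ℙ k (ι → k))} {z : ι → k} (hz : z ∈ cone T) (c : k) :
    c • z ∈ cone T := by
  intro h
  have hz0 : z ≠ 0 := fun h0 => h (by rw [h0, smul_zero])
  have hc : c ≠ 0 := fun h0 => h (by rw [h0, zero_smul])
  convert hz hz0 using 1
  rw [Projectivization.mk_eq_mk_iff']
  exact ⟨c, rfl⟩

theorem rep_mem_cone {T : Set (ℙ k (ι → k))} {p : ℙ k (ι → k)} (hp : p ∈ T) : p.rep ∈ cone T := by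
  intro h
  rwa [Projectivization.mk_rep]

theorem exists_smul_rep_of_mem_cone {T : Set (ℙ k (ι → k))} (hT : T.Nonempty) {z : ι → k}
    (hz : z ∈ cone T) : ∃ p ∈ T, ∃ c : k, z = c • p.rep := by
  by_cases h : z = 0
  · obtain ⟨p, hp⟩ := hT
    exact ⟨p, hp, 0, by rw [h, zero_smul]⟩
  · obtain ⟨a, ha⟩ := Projectivization.exists_smul_eq_mk_rep k z h
    refine ⟨_, hz h, ((a⁻¹ : kˣ) : k), ?_⟩
    rw [← ha, Units.smul_def, smul_smul, Units.inv_mul, one_smul]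

theorem cone_univ : cone (Set.univ : Set (ℙ k (ι → k))) = Set.univ :=
  Set.eq_univ_of_forall fun _ _ => Set.mem_univ _

theorem cone_hyperplane (l : (ι → k) →ₗ[k] k) :
    cone {q : ℙ k (ι → k) | l q.rep = 0} = {z | l z = 0} := by
  ext z
  by_cases h : z = 0
  · subst h
    simp [zero_mem_cone]
  · obtain ⟨a, ha⟩ := Projectivization.exists_smul_eq_mk_rep k z h
    have : z ∈ cone {q : ℙ k (ι → k) | l q.rep = 0} ↔ l (Projectivization.mk k z h).rep = 0 :=
      ⟨fun hz => hz h, fun hz _ => hz⟩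
    rw [this, ← ha, Units.smul_def, map_smul, smul_eq_mul, mul_eq_zero]
    simp

/-- The affine version of the Segre map. -/
def tensorVec (p : ι → k) (q : κ → k) : ι × κ → k := fun ij => p ij.1 * q ij.2

theorem smul_tensorVec (c : k) (p : ι → k) (q : κ → k) :
    c • tensorVec p q = tensorVec (c • p) q := by
  ext ij
  simp [tensorVec, mul_assoc]

theorem mem_cone_segreProd {V : Set (ℙ k (ι → k))} {W : Set (ℙ k (κ → k))} {z : ι × κ → k} :
    z ∈ cone (segreProd V W) ↔ ∃ p ∈ cone V, ∃ q ∈ cone W, z = tensorVec p q := by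
  constructor
  · intro hz
    by_cases h : z = 0
    · exact ⟨0, zero_mem_cone _, 0, zero_mem_cone _, by rw [h]; ext; simp [tensorVec]⟩
    · obtain ⟨p, hp, q, hq, hpq⟩ := hz h
      obtain ⟨c, hc⟩ := (Projectivization.mk_eq_mk_iff' _ _ _ _ _).1 hpq.symm
      exact ⟨c • p.rep, smul_mem_cone (rep_mem_cone hp) c, q.rep, rep_mem_cone hq,
        by rw [← smul_tensorVec, ← hc]; rfl⟩
  · rintro ⟨p, hp, q, hq, rfl⟩ h
    have hp0 : p ≠ 0 := by rintro rfl; exact h (by ext; simp [tensorVec])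
    have hq0 : q ≠ 0 := by rintro rfl; exact h (by ext; simp [tensorVec])
    refine ⟨_, hp hp0, _, hq hq0, ?_⟩
    obtain ⟨a, ha⟩ := Projectivization.exists_smul_eq_mk_rep k p hp0
    obtain ⟨b, hb⟩ := Projectivization.exists_smul_eq_mk_rep k q hq0
    rw [segre, Projectivization.mk_eq_mk_iff']
    refine ⟨a * b, ?_⟩
    ext ij
    rw [← ha, ← hb]
    simp only [tensorVec, Pi.smul_apply, Units.smul_def, smul_eq_mul]
    ring

theorem aeval_mul_of_isHomogeneous {B : Type*} [CommRing B] [Algebra k B]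
    {F : MvPolynomial ι k} {d : ℕ} (hF : F.IsHomogeneous d) (c : B) (z : ι → B) :
    MvPolynomial.aeval (fun i => c * z i) F = c ^ d * MvPolynomial.aeval z F := by
  rw [MvPolynomial.aeval_def, MvPolynomial.aeval_def, MvPolynomial.eval₂_eq,
    MvPolynomial.eval₂_eq, Finset.mul_sum]
  refine Finset.sum_congr rfl fun e he => ?_
  rw [hF.degree_eq_sum_deg_support he]
  simp only [mul_pow, Finset.prod_mul_distrib, Finset.prod_pow_eq_pow_sum]
  ring

theorem eval_smul_of_isHomogeneous {F : MvPolynomial ι k} {d : ℕ} (hF : F.IsHomogeneous d) (c : k)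
    (z : ι → k) : MvPolynomial.eval (c • z) F = c ^ d * MvPolynomial.eval z F :=
  aeval_mul_of_isHomogeneous hF c z

/-- The homogeneous components of a polynomial that vanishes on a line through the origin vanish
there as well. -/
theorem eval_homogeneousComponent_eq_zero [Infinite k] {F : MvPolynomial ι k} {z : ι → k}
    (h : ∀ c : k, MvPolynomial.eval (c • z) F = 0) (d : ℕ) :
    MvPolynomial.eval z (MvPolynomial.homogeneousComponent d F) = 0 := by
  let P : Polynomial k := ∑ e ∈ Finset.range (F.totalDegree + 1),
    Polynomial.monomial e (MvPolynomial.eval z (MvPolynomial.homogeneousComponent e F))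
  have hP : P = 0 := by
    refine Polynomial.funext fun c => ?_
    rw [Polynomial.eval_zero, ← h c]
    conv_rhs => rw [← MvPolynomial.sum_homogeneousComponent F, map_sum]
    rw [Polynomial.eval_finsetSum]
    refine Finset.sum_congr rfl fun e _ => ?_
    rw [Polynomial.eval_monomial, eval_smul_of_isHomogeneous
      (MvPolynomial.homogeneousComponent_isHomogeneous e F), mul_comm]
  by_cases hd : d < F.totalDegree + 1
  · have := congrArg (fun Q => Polynomial.coeff Q d) hP
    simpa [P, Polynomial.finsetSum_coeff, Polynomial.coeff_monomial, hd] using this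
  · rw [MvPolynomial.homogeneousComponent_eq_zero _ _ (by omega), map_zero]

/-- `I(V)` is the ideal of polynomials that vanish on the cone over `V`. -/
theorem mem_projIdeal_iff [Infinite k] {V : Set (ℙ k (ι → k))} (hV : V.Nonempty)
    {F : MvPolynomial ι k} :
    F ∈ (projIdeal V).toIdeal ↔ ∀ z ∈ cone V, MvPolynomial.eval z F = 0 := by
  constructor
  · intro hF z hz
    obtain ⟨p, hp, c, rfl⟩ := exists_smul_rep_of_mem_cone hV hz
    have hle : (projIdeal V).toIdeal ≤ RingHom.ker (MvPolynomial.eval (c • p.rep)) := by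
      refine Ideal.span_le.2 ?_
      rintro G ⟨⟨d, hd⟩, hG⟩
      rw [SetLike.mem_coe, RingHom.mem_ker, eval_smul_of_isHomogeneous hd, hG p hp, mul_zero]
    exact hle hF
  · intro h
    rw [← MvPolynomial.sum_homogeneousComponent F]
    refine Ideal.sum_mem _ fun d _ => Ideal.subset_span
      ⟨⟨d, MvPolynomial.homogeneousComponent_isHomogeneous d F⟩, fun p hp => ?_⟩
    exact eval_homogeneousComponent_eq_zero (fun c => h _ (smul_mem_cone (rep_mem_cone hp) c)) d

theorem projIdeal_isPrime [Infinite k] {V : Set (ℙ k (ι → k))} (hV : V.Nonempty)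
    (hirr : ∀ A B : Set (ℙ k (ι → k)), IsProjAlgebraicSet A → IsProjAlgebraicSet B →
      V ⊆ A ∪ B → V ⊆ A ∨ V ⊆ B) : (projIdeal V).toIdeal.IsPrime := by
  refine (projIdeal V).isHomogeneous.isPrime_of_homogeneous_mem_or_mem ?_ ?_
  · intro h
    have := (mem_projIdeal_iff hV (F := 1)).1 (h ▸ Submodule.mem_top) 0 (zero_mem_cone _)
    simp at this
  · rintro F G ⟨d, hF⟩ ⟨e, hG⟩ hFG
    have hF' : F.IsHomogeneous d := hF
    have hG' : G.IsHomogeneous e := hG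
    have hsub := hirr {p | ∀ g ∈ ({F} : Set (MvPolynomial ι k)), MvPolynomial.eval p.rep g = 0}
      {p | ∀ g ∈ ({G} : Set (MvPolynomial ι k)), MvPolynomial.eval p.rep g = 0}
      ⟨{F}, by rintro _ rfl; exact ⟨d, hF'⟩, rfl⟩ ⟨{G}, by rintro _ rfl; exact ⟨e, hG'⟩, rfl⟩ ?_
    · refine hsub.imp (fun h => ?_) (fun h => ?_)
      · exact Ideal.subset_span ⟨⟨d, hF'⟩, fun p hp => h hp _ rfl⟩
      · exact Ideal.subset_span ⟨⟨e, hG'⟩, fun p hp => h hp _ rfl⟩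
    · intro p hp
      have := (mem_projIdeal_iff hV).1 hFG _ (rep_mem_cone hp)
      rw [map_mul, mul_eq_zero] at this
      refine this.imp (fun h => ?_) (fun h => ?_)
      · rintro _ rfl; exact h
      · rintro _ rfl; exact h

theorem mem_vanishingIdeal_cone_segreProd {V : Set (ℙ k (ι → k))} {W : Set (ℙ k (κ → k))}
    {F : MvPolynomial (ι × κ) k} :
    F ∈ MvPolynomial.vanishingIdeal k (cone (segreProd V W)) ↔
      ∀ p ∈ cone V, ∀ q ∈ cone W, MvPolynomial.eval (tensorVec p q) F = 0 := by
  rw [MvPolynomial.mem_vanishingIdeal_iff]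
  constructor
  · intro h p hp q hq
    exact h _ (mem_cone_segreProd.2 ⟨p, hp, q, hq, rfl⟩)
  · intro h z hz
    obtain ⟨p, hp, q, hq, rfl⟩ := mem_cone_segreProd.1 hz
    exact h p hp q hq

theorem mem_vanishingIdeal_cone_segreProd_univ {V : Set (ℙ k (ι → k))}
    {F : MvPolynomial (ι × κ) k} :
    F ∈ MvPolynomial.vanishingIdeal k (cone (segreProd V (Set.univ : Set (ℙ k (κ → k))))) ↔
      ∀ p ∈ cone V, ∀ q, MvPolynomial.eval (tensorVec p q) F = 0 := by
  rw [mem_vanishingIdeal_cone_segreProd, cone_univ]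
  simp

/-- The cone over the product of an irreducible projective variety and a projective space is
irreducible. -/
theorem vanishingIdeal_cone_isPrime [Infinite k] {V : Set (ℙ k (ι → k))} (hV : V.Nonempty)
    (hprime : (projIdeal V).toIdeal.IsPrime) :
    (MvPolynomial.vanishingIdeal k
      (cone (segreProd V (Set.univ : Set (ℙ k (κ → k)))))).IsPrime := by
  refine ⟨fun h => ?_, fun {F G} hFG => ?_⟩
  · have := (mem_vanishingIdeal_cone_segreProd_univ (V := V) (κ := κ) (F := 1)).1
      (h ▸ Submodule.mem_top) 0 (zero_mem_cone _) 0
    simp at this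
  · by_contra! hne
    rw [mem_vanishingIdeal_cone_segreProd_univ, mem_vanishingIdeal_cone_segreProd_univ] at hne
    push Not at hne
    obtain ⟨⟨p₀, hp₀, q₀, h₀⟩, ⟨p₁, hp₁, q₁, h₁⟩⟩ := hne
    let L : (ι → k) → MvPolynomial (ι × κ) k →ₐ[k] MvPolynomial κ k := fun p =>
      MvPolynomial.aeval fun ij => MvPolynomial.C (p ij.1) * MvPolynomial.X ij.2
    have hL : ∀ p q F, MvPolynomial.eval q (L p F) = MvPolynomial.eval (tensorVec p q) F := by
      intro p q F
      induction F using MvPolynomial.induction_on with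
      | C a => simp [L]
      | add F G hF hG => simp [hF, hG]
      | mul_X F i hF => simp [hF]; simp [L, tensorVec]
    let M : (κ → k) → MvPolynomial (ι × κ) k →ₐ[k] MvPolynomial ι k := fun q =>
      MvPolynomial.aeval fun ij => MvPolynomial.X ij.1 * MvPolynomial.C (q ij.2)
    have hM : ∀ p q F, MvPolynomial.eval p (M q F) = MvPolynomial.eval (tensorVec p q) F := by
      intro p q F
      induction F using MvPolynomial.induction_on with
      | C a => simp [M]
      | add F G hF hG => simp [hF, hG]
      | mul_X F i hF => simp [hF]; simp [M, tensorVec]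
    have hne : L p₀ F * L p₁ G ≠ 0 := by
      refine mul_ne_zero (fun h => h₀ ?_) (fun h => h₁ ?_)
      · rw [← hL, h, map_zero]
      · rw [← hL, h, map_zero]
    obtain ⟨q, hq⟩ : ∃ q, MvPolynomial.eval q (L p₀ F * L p₁ G) ≠ 0 := by
      by_contra! h
      exact hne (MvPolynomial.funext fun q => by rw [h q, map_zero])
    rw [map_mul, hL, hL] at hq
    have hmul : M q F * M q G ∈ (projIdeal V).toIdeal := by
      rw [mem_projIdeal_iff hV]
      intro p hp
      rw [map_mul, hM, hM, ← map_mul]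
      exact mem_vanishingIdeal_cone_segreProd_univ.1 hFG p hp q
    rcases hprime.mem_or_mem hmul with h | h
    · have := (mem_projIdeal_iff hV).1 h _ hp₀
      rw [hM] at this
      exact hq (by rw [this, zero_mul])
    · have := (mem_projIdeal_iff hV).1 h _ hp₁
      rw [hM] at this
      exact hq (by rw [this, mul_zero])

end Cones

end

end ConeBlowup

namespace ConeBlowup

noncomputable section

section FiberRing

attribute [local instance] MvPolynomial.gradedAlgebra
open Graded

/-- An injective homomorphism of graded rings reflects degrees. -/
theorem mem_iff_of_injective {R A K B : Type u} [CommRing R] [CommRing A] [Algebra R A]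
    {𝒜 : ℕ → Submodule R A} [GradedAlgebra 𝒜] [CommRing K] [CommRing B] [Algebra K B]
    {ℬ : ℕ → Submodule K B} [GradedAlgebra ℬ] (e : A →+* B) (he : ∀ d, ∀ a ∈ 𝒜 d, e a ∈ ℬ d)
    (hinj : Function.Injective e) (d : ℕ) (a : A) : a ∈ 𝒜 d ↔ e a ∈ ℬ d := by
  classical
  refine ⟨he d a, fun h => ?_⟩
  let f : 𝒜 →+*ᵍ ℬ := ⟨e, fun {d a} h => he d a h⟩
  have h1 : (DirectSum.decompose 𝒜 a d : A) = a := by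
    apply hinj
    change f _ = f a
    rw [GradedRingHom.map_directSumDecompose, DirectSum.decompose_of_mem_same _ (show f a ∈ ℬ d from h)]
  rw [← h1]
  exact SetLike.coe_mem _

variable {k R : Type u} [Field k] [CommRing R] [Algebra k R] {ι : Type} (I 𝔪 : Ideal R)
  (z : ι → R) (hz : ∀ i, z i ∈ I ^ 1)

/-- The homomorphism `k[x] → ⨁ I ^ d` that sends `x_i` to `z_i` in degree one. -/
def toRees : MvPolynomial ι k →ₐ[k] reesAlgebra I :=
  MvPolynomial.aeval fun i => reesMonomial I 1 (z i) (hz i)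

theorem toRees_of_isHomogeneous {F : MvPolynomial ι k} {d : ℕ} (hF : F.IsHomogeneous d) :
    (toRees I z hz F : Polynomial R) = Polynomial.monomial d (MvPolynomial.aeval z F) := by
  have h1 : (toRees I z hz F : Polynomial R) =
      MvPolynomial.aeval (fun i => (Polynomial.X : Polynomial R) * Polynomial.C (z i)) F := by
    have : ((reesAlgebra I).val.restrictScalars k).comp (toRees I z hz) =
        MvPolynomial.aeval (fun i => (Polynomial.X : Polynomial R) * Polynomial.C (z i)) := by
      ext i : 1
      rw [AlgHom.comp_apply, toRees, MvPolynomial.aeval_X, MvPolynomial.aeval_X, mul_comm,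
        Polynomial.C_mul_X_eq_monomial]
      rfl
    exact DFunLike.congr_fun this F
  have h2 : MvPolynomial.aeval (fun i => (Polynomial.C (z i) : Polynomial R)) F =
      Polynomial.C (MvPolynomial.aeval z F) := by
    have : MvPolynomial.aeval (fun i => (Polynomial.C (z i) : Polynomial R)) =
        ((Polynomial.CAlgHom : R →ₐ[R] Polynomial R).restrictScalars k).comp (MvPolynomial.aeval (R := k) z) := by
      ext i : 1
      simp
    exact DFunLike.congr_fun this F
  rw [h1, aeval_mul_of_isHomogeneous hF, h2, mul_comm, Polynomial.C_mul_X_pow_eq_monomial]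

theorem toRees_mem_reesGrading {F : MvPolynomial ι k} {d : ℕ} (hF : F.IsHomogeneous d) :
    toRees I z hz F ∈ reesGrading I d := by
  intro i hi
  rw [toRees_of_isHomogeneous I z hz hF, Polynomial.coeff_monomial, if_neg hi.symm]

theorem coeff_toRees (F : MvPolynomial ι k) (d : ℕ) :
    (toRees I z hz F : Polynomial R).coeff d =
      MvPolynomial.aeval z (MvPolynomial.homogeneousComponent d F) := by
  conv_lhs => rw [← MvPolynomial.sum_homogeneousComponent F, map_sum]
  rw [AddSubmonoidClass.coe_finsetSum, Polynomial.finsetSum_coeff]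
  simp only [toRees_of_isHomogeneous I z hz (MvPolynomial.homogeneousComponent_isHomogeneous _ F),
    Polynomial.coeff_monomial]
  rw [Finset.sum_ite_eq']
  split_ifs with h
  · rfl
  · rw [MvPolynomial.homogeneousComponent_eq_zero _ _ (by simpa using h), map_zero]

/-- The homomorphism `k[x] → ⨁ I ^ d / I ^ d 𝔪` that sends `x_i` to the class of `z_i` in degree
one. -/
def toFiberRing : MvPolynomial ι k →ₐ[k] FiberRing I 𝔪 :=
  (Ideal.Quotient.mkₐ k (reesMulIdeal I 𝔪).toIdeal).comp (toRees I z hz)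

variable (P : HomogeneousIdeal (MvPolynomial.homogeneousSubmodule ι k))
  (hP : ∀ d (F : MvPolynomial ι k), F.IsHomogeneous d →
    (MvPolynomial.aeval z F ∈ I ^ d * 𝔪 ↔ F ∈ P.toIdeal))

include hP in
theorem ker_toFiberRing : RingHom.ker (toFiberRing I 𝔪 z hz) = P.toIdeal := by
  ext F
  rw [MvPolynomial.mem_iff_homogeneousComponent_mem P.isHomogeneous, RingHom.mem_ker]
  change Ideal.Quotient.mk _ (toRees I z hz F) = 0 ↔ _
  rw [Ideal.Quotient.eq_zero_iff_mem]
  change (∀ d, (toRees I z hz F : Polynomial R).coeff d ∈ I ^ d * 𝔪) ↔ _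
  refine forall_congr' fun d => ?_
  rw [coeff_toRees]
  exact hP d _ (MvPolynomial.homogeneousComponent_isHomogeneous d F)

variable (ρ : R →ₐ[k] k) (hρ : RingHom.ker ρ = 𝔪)

include hρ in
theorem mk_algebraMap_eq (r : R) :
    (Ideal.Quotient.mk (reesMulIdeal I 𝔪).toIdeal (algebraMap R (reesAlgebra I) r) :
      FiberRing I 𝔪) = algebraMap k (FiberRing I 𝔪) (ρ r) := by
  have h : algebraMap k (FiberRing I 𝔪) (ρ r) = Ideal.Quotient.mk (reesMulIdeal I 𝔪).toIdeal
      (algebraMap R (reesAlgebra I) (algebraMap k R (ρ r))) := rfl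
  rw [h, Ideal.Quotient.eq, ← map_sub]
  intro d
  change (Polynomial.C (r - algebraMap k R (ρ r))).coeff d ∈ _
  rw [Polynomial.coeff_C]
  split_ifs with hd
  · subst hd
    rw [pow_zero, Ideal.one_eq_top, Ideal.top_mul, ← hρ, RingHom.mem_ker, map_sub]
    simp
  · exact zero_mem _

include hρ in
theorem toFiberRing_surjective (hI : I = Ideal.span (Set.range z)) :
    Function.Surjective (toFiberRing (k := k) I 𝔪 z hz) := by
  let T : Subalgebra R (reesAlgebra I) :=
    { carrier := {p | Ideal.Quotient.mk (reesMulIdeal I 𝔪).toIdeal p ∈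
        (toFiberRing (k := k) I 𝔪 z hz).range}
      mul_mem' := fun {p q} hp hq => by
        rw [Set.mem_ofPred_eq, map_mul]
        exact mul_mem hp hq
      add_mem' := fun {p q} hp hq => by
        rw [Set.mem_ofPred_eq, map_add]
        exact add_mem hp hq
      algebraMap_mem' := fun r => by
        rw [Set.mem_ofPred_eq, mk_algebraMap_eq I 𝔪 ρ hρ]
        exact algebraMap_mem _ _ }
  have hmono : ∀ b (hb : b ∈ I ^ 1), reesMonomial I 1 b hb ∈ T := by
    intro b hb
    suffices ∃ hb, reesMonomial I 1 b hb ∈ T from this.2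
    have hb' : b ∈ Ideal.span (Set.range z) := by rwa [pow_one, hI] at hb
    clear hb
    induction hb' using Submodule.span_induction with
    | mem b hb =>
      obtain ⟨i, rfl⟩ := hb
      refine ⟨hz i, MvPolynomial.X i, ?_⟩
      change Ideal.Quotient.mk _ (toRees I z hz (MvPolynomial.X i)) = _
      rw [toRees, MvPolynomial.aeval_X]
    | zero =>
      refine ⟨zero_mem _, ?_⟩
      have : reesMonomial I 1 0 (zero_mem _) = 0 := Subtype.ext (map_zero _)
      rw [this]
      exact zero_mem T
    | add b c _ _ ihb ihc =>
      obtain ⟨hb, ihb⟩ := ihb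
      obtain ⟨hc, ihc⟩ := ihc
      refine ⟨add_mem hb hc, ?_⟩
      rw [reesMonomial_add I 1 b c hb hc]
      exact add_mem ihb ihc
    | smul r b _ ihb =>
      obtain ⟨hb, ihb⟩ := ihb
      refine ⟨Ideal.mul_mem_left _ _ hb, ?_⟩
      have := algebraMap_mul_reesMonomial I 1 r b hb
      simp only [smul_eq_mul]
      rw [← this]
      exact mul_mem (T.algebraMap_mem r) ihb
  have hle : reesAlgebra I ≤ T.map (reesAlgebra I).val := by
    refine (adjoin_monomial_eq_reesAlgebra I).ge.trans (Algebra.adjoin_le ?_)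
    rintro _ ⟨b, hb, rfl⟩
    exact ⟨reesMonomial I 1 b (by simpa using hb), hmono _ _, rfl⟩
  intro x
  obtain ⟨p, rfl⟩ := Ideal.Quotient.mk_surjective x
  obtain ⟨q, hq, hqp⟩ := hle p.2
  obtain rfl : q = p := Subtype.ext hqp
  exact hq

/-- The ring `⨁ I ^ d / I ^ d 𝔪` is a quotient of a polynomial ring. -/
def fiberRingEquiv (hI : I = Ideal.span (Set.range z)) :
    FiberRing I 𝔪 ≃ₐ[k] MvPolynomial ι k ⧸ P.toIdeal :=
  ((Ideal.quotientEquivAlgOfEq k (ker_toFiberRing I 𝔪 z hz P hP).symm).trans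
    (Ideal.quotientKerAlgEquivOfSurjective
      (toFiberRing_surjective I 𝔪 z hz ρ hρ hI))).symm

theorem fiberRingEquiv_symm_mk (hI : I = Ideal.span (Set.range z)) (F : MvPolynomial ι k) :
    (fiberRingEquiv I 𝔪 z hz P hP ρ hρ hI).symm (Ideal.Quotient.mk _ F) =
      Ideal.Quotient.mk _ (toRees I z hz F) := rfl

theorem fiberRingEquiv_reesMonomial (hI : I = Ideal.span (Set.range z)) (i : ι) :
    fiberRingEquiv I 𝔪 z hz P hP ρ hρ hI (Ideal.Quotient.mk _ (reesMonomial I 1 (z i) (hz i))) =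
      Ideal.Quotient.mk _ (MvPolynomial.X i) := by
  refine ((AlgEquiv.symm_apply_eq _).1 ?_).symm
  rw [fiberRingEquiv_symm_mk, toRees, MvPolynomial.aeval_X]

theorem mem_fiberGrading_iff (hI : I = Ideal.span (Set.range z)) (d : ℕ) (a : FiberRing I 𝔪) :
    a ∈ fiberGrading I 𝔪 d ↔ fiberRingEquiv I 𝔪 z hz P hP ρ hρ hI a ∈
      quotGrading (MvPolynomial.homogeneousSubmodule ι k) P.toIdeal d := by
  let e := fiberRingEquiv I 𝔪 z hz P hP ρ hρ hI
  have h := mem_iff_of_injective (A := MvPolynomial ι k ⧸ P.toIdeal) (B := FiberRing I 𝔪)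
    (𝒜 := quotGrading (MvPolynomial.homogeneousSubmodule ι k) P.toIdeal) (ℬ := fiberGrading I 𝔪) (e.symm : (MvPolynomial ι k ⧸ P.toIdeal) →+* FiberRing I 𝔪) (by
      rintro d _ ⟨F, hF, rfl⟩
      exact ⟨toRees I z hz F, toRees_mem_reesGrading I z hz hF, rfl⟩) e.symm.injective d (e a)
  rw [h]
  change _ ↔ e.symm (e a) ∈ _
  rw [e.symm_apply_apply]

/-- The homomorphism from the Rees algebra to the quotient of a polynomial ring that presents its
fibre. -/
def reesToQuot (hI : I = Ideal.span (Set.range z)) :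
    reesAlgebra I →+* MvPolynomial ι k ⧸ P.toIdeal :=
  (fiberRingEquiv I 𝔪 z hz P hP ρ hρ hI : FiberRing I 𝔪 →+* MvPolynomial ι k ⧸ P.toIdeal).comp
    (Ideal.Quotient.mk (reesMulIdeal I 𝔪).toIdeal)

theorem reesToQuot_mem (hI : I = Ideal.span (Set.range z)) (d : ℕ) (a : reesAlgebra I)
    (ha : a ∈ reesGrading I d) : reesToQuot I 𝔪 z hz P hP ρ hρ hI a ∈
      quotGrading (MvPolynomial.homogeneousSubmodule ι k) P.toIdeal d :=
  (mem_fiberGrading_iff I 𝔪 z hz P hP ρ hρ hI d _).1 ⟨a, ha, rfl⟩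

theorem reesToQuot_surjective (hI : I = Ideal.span (Set.range z)) :
    Function.Surjective (reesToQuot I 𝔪 z hz P hP ρ hρ hI) :=
  (fiberRingEquiv I 𝔪 z hz P hP ρ hρ hI).surjective.comp Ideal.Quotient.mk_surjective

theorem reesToQuot_algebraMap (hI : I = Ideal.span (Set.range z)) (r : R) :
    reesToQuot I 𝔪 z hz P hP ρ hρ hI (algebraMap R (reesAlgebra I) r) =
      algebraMap k (MvPolynomial ι k ⧸ P.toIdeal) (ρ r) := by
  change fiberRingEquiv I 𝔪 z hz P hP ρ hρ hI
    (Ideal.Quotient.mk (reesMulIdeal I 𝔪).toIdeal (algebraMap R (reesAlgebra I) r)) = _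
  rw [mk_algebraMap_eq I 𝔪 ρ hρ, AlgEquiv.commutes]

theorem mem_smul_of_reesToQuot_eq_zero (hI : I = Ideal.span (Set.range z)) (d : ℕ)
    (a : reesAlgebra I) (ha : a ∈ reesGrading I d)
    (h : reesToQuot I 𝔪 z hz P hP ρ hρ hI a = 0) : a ∈ RingHom.ker ρ • reesGrading I d := by
  have h0 : Ideal.Quotient.mk (reesMulIdeal I 𝔪).toIdeal a = 0 :=
    (fiberRingEquiv I 𝔪 z hz P hP ρ hρ hI).injective (h.trans (map_zero _).symm)
  rw [Ideal.Quotient.eq_zero_iff_mem] at h0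
  obtain ⟨b, hb, rfl⟩ := (mem_reesGrading_iff I).1 ha
  have hb' : b ∈ I ^ d * 𝔪 := by
    have := h0 d
    simpa [reesMonomial] using this
  suffices ∃ hb, reesMonomial I d b hb ∈ RingHom.ker ρ • reesGrading I d from this.2
  rw [hρ]
  clear h h0 ha hb
  induction hb' using Submodule.mul_induction_on' with
  | mem_mul_mem b hb c hc =>
    refine ⟨Ideal.mul_mem_right _ _ hb, ?_⟩
    have : reesMonomial I d (b * c) (Ideal.mul_mem_right _ _ hb) = c • reesMonomial I d b hb :=
      Subtype.ext (by simp [reesMonomial, Polynomial.smul_monomial, mul_comm])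
    rw [this]
    exact Submodule.smul_mem_smul hc (reesMonomial_mem I d b hb)
  | add b hb c hc ihb ihc =>
    obtain ⟨hb, ihb⟩ := ihb
    obtain ⟨hc, ihc⟩ := ihc
    refine ⟨add_mem hb hc, ?_⟩
    rw [reesMonomial_add I d b c hb hc]
    exact add_mem ihb ihc

end FiberRing

end

end ConeBlowup

namespace ConeBlowup

noncomputable section

section SegreCone

attribute [local instance] MvPolynomial.gradedAlgebra

variable {k : Type u} [Field k] {n m : ℕ}

/-- A nonzero linear form is the last row of an invertible matrix. -/
theorem exists_matrix_mulVec_last (l : (Fin (m + 1) → k) →ₗ[k] k) (hl : l ≠ 0) :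
    ∃ A : Matrix (Fin (m + 1)) (Fin (m + 1)) k, IsUnit A.det ∧
      ∀ q, A.mulVec q (Fin.last m) = l q := by
  let b : Fin (m + 1) → k := fun j => l (Pi.single j 1)
  have hb : ∀ q, b ⬝ᵥ q = l q := by
    intro q
    conv_rhs => rw [LinearMap.pi_apply_eq_sum_univ l q]
    refine Finset.sum_congr rfl fun j _ => ?_
    rw [smul_eq_mul, mul_comm]
    have : (Pi.single j 1 : Fin (m + 1) → k) = fun i => if j = i then 1 else 0 := by
      ext i
      simp [Pi.single_apply, eq_comm]
    rw [← this]
  obtain ⟨j, hj⟩ : ∃ j, b j ≠ 0 := by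
    by_contra! h
    refine hl (LinearMap.ext fun q => ?_)
    rw [← hb, LinearMap.zero_apply]
    exact Finset.sum_eq_zero fun i _ => by rw [h i, zero_mul]
  refine ⟨((1 : Matrix (Fin (m + 1)) (Fin (m + 1)) k).updateRow j b).submatrix
    (Equiv.swap j (Fin.last m)) id, ?_, fun q => ?_⟩
  · rw [Matrix.det_permute, isUnit_iff_ne_zero]
    refine mul_ne_zero ?_ ?_
    · rcases Int.units_eq_one_or (Equiv.Perm.sign (Equiv.swap j (Fin.last m))) with h | h <;>
        rw [h] <;> simp
    · rw [← Matrix.cramer_transpose_apply, Matrix.transpose_one, Matrix.cramer_one]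
      exact hj
  · rw [← hb]
    simp [Matrix.mulVec]

variable {V : Set (ℙ k (Fin (n + 1) → k))} {H : Set (ℙ k (Fin (m + 1) → k))}
  (A : Matrix (Fin (m + 1)) (Fin (m + 1)) k)

/-- The linear form `z'_{ij} = ∑ A_{jl} z_{il}`. -/
def segreForm (i : Fin (n + 1)) (j : Fin (m + 1)) :
    MvPolynomial (Fin (n + 1) × Fin (m + 1)) k :=
  ∑ l, MvPolynomial.C (A j l) * MvPolynomial.X (i, l)

theorem eval_segreForm (i : Fin (n + 1)) (j : Fin (m + 1)) (p : Fin (n + 1) → k)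
    (q : Fin (m + 1) → k) :
    MvPolynomial.eval (tensorVec p q) (segreForm A i j) = p i * A.mulVec q j := by
  rw [segreForm, map_sum, Matrix.mulVec, dotProduct, Finset.mul_sum]
  refine Finset.sum_congr rfl fun l _ => ?_
  simp only [map_mul, MvPolynomial.eval_C, MvPolynomial.eval_X, tensorVec]
  ring

theorem mk_segreForm (i : Fin (n + 1)) (j : Fin (m + 1)) :
    (Ideal.Quotient.mk (MvPolynomial.vanishingIdeal k (coneY m V)) (segreForm A i j)) =
      segreCoord (coneY m V) A i j := rfl

theorem mk_eq_zero_iff {F : MvPolynomial (Fin (n + 1) × Fin (m + 1)) k} :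
    Ideal.Quotient.mk (MvPolynomial.vanishingIdeal k (coneY m V)) F = 0 ↔
      ∀ p ∈ cone V, ∀ q, MvPolynomial.eval (tensorVec p q) F = 0 := by
  rw [Ideal.Quotient.eq_zero_iff_mem, mem_vanishingIdeal_cone_segreProd_univ]

theorem segreCoord_eq_zero_iff (i : Fin (n + 1)) (j : Fin (m + 1)) :
    segreCoord (coneY m V) A i j = 0 ↔ ∀ p ∈ cone V, ∀ q, p i * A.mulVec q j = 0 := by
  rw [← mk_segreForm, mk_eq_zero_iff]
  simp only [eval_segreForm]

theorem segreCoord_mul_segreCoord (i i' : Fin (n + 1)) (j j' : Fin (m + 1)) :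
    segreCoord (coneY m V) A i j * segreCoord (coneY m V) A i' j' =
      segreCoord (coneY m V) A i' j * segreCoord (coneY m V) A i j' := by
  rw [← sub_eq_zero]
  simp only [← mk_segreForm, ← map_mul, ← map_sub]
  rw [mk_eq_zero_iff]
  intro p _ q
  simp only [map_sub, map_mul, eval_segreForm]
  ring

variable {A} (hA : IsUnit A.det)

include hA in
theorem exists_mulVec_eq_one (j : Fin (m + 1)) : ∃ q, A.mulVec q j = 1 := by
  refine ⟨A⁻¹.mulVec (Pi.single j 1), ?_⟩
  rw [Matrix.mulVec_mulVec, Matrix.mul_nonsing_inv _ hA, Matrix.one_mulVec, Pi.single_eq_same]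

include hA in
theorem segreCoord_last_ne_zero {i : Fin (n + 1)} {j : Fin (m + 1)}
    (h : segreCoord (coneY m V) A i j ≠ 0) : segreCoord (coneY m V) A i (Fin.last m) ≠ 0 := by
  contrapose! h
  rw [segreCoord_eq_zero_iff] at h ⊢
  intro p hp q
  obtain ⟨q', hq'⟩ := exists_mulVec_eq_one hA (Fin.last m)
  have := h p hp q'
  rw [hq', mul_one] at this
  rw [this, zero_mul]

include hA in
/-- The ideal of the subcone `C(V × H)` is generated by the coordinates that vanish on `H`. -/
theorem centerIdeal_eq_span (hH : cone H = {q | A.mulVec q (Fin.last m) = 0}) :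
    centerIdeal V H =
      Ideal.span (Set.range fun i => segreCoord (coneY m V) A i (Fin.last m)) := by
  apply le_antisymm
  · refine Ideal.map_le_iff_le_comap.2 fun G hG => ?_
    let J := Ideal.span (Set.range fun i => segreCoord (coneY m V) A i (Fin.last m))
    let π : MvPolynomial (Fin (n + 1) × Fin (m + 1)) k →ₐ[k]
        MvPolynomial (Fin (n + 1) × Fin (m + 1)) k := MvPolynomial.aeval fun il =>
      MvPolynomial.X il - MvPolynomial.C (A⁻¹ il.2 (Fin.last m)) * segreForm A il.1 (Fin.last m)
    have hπ : ∀ (p : Fin (n + 1) → k) (q : Fin (m + 1) → k) F,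
        MvPolynomial.eval (tensorVec p q) (π F) = MvPolynomial.eval (tensorVec p
          (q - A.mulVec q (Fin.last m) • A⁻¹.mulVec (Pi.single (Fin.last m) 1))) F := by
      intro p q F
      induction F using MvPolynomial.induction_on with
      | C a => simp [π]
      | add F G hF hG => simp [hF, hG]
      | mul_X F il hF =>
        rw [map_mul, map_mul, map_mul, hF]
        congr 1
        simp only [π, MvPolynomial.aeval_X, map_sub, map_mul, MvPolynomial.eval_X,
          MvPolynomial.eval_C, eval_segreForm]
        simp [tensorVec]
        ring
    have h0 : Ideal.Quotient.mk (MvPolynomial.vanishingIdeal k (coneY m V)) (π G) = 0 := by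
      rw [mk_eq_zero_iff]
      intro p hp q
      rw [hπ]
      refine mem_vanishingIdeal_cone_segreProd.1 hG p hp _ ?_
      rw [hH, Set.mem_ofPred_eq, Matrix.mulVec_sub, Matrix.mulVec_smul, Matrix.mulVec_mulVec,
        Matrix.mul_nonsing_inv _ hA, Matrix.one_mulVec]
      simp
    let J' := J.comap (Ideal.Quotient.mk (MvPolynomial.vanishingIdeal k (coneY m V)))
    have hφ : Ideal.Quotient.mkₐ k J' = (Ideal.Quotient.mkₐ k J').comp π := by
      ext il
      have : Ideal.Quotient.mkₐ k J' (segreForm A il.1 (Fin.last m)) = 0 :=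
        Ideal.Quotient.eq_zero_iff_mem.2 (Ideal.subset_span ⟨il.1, rfl⟩)
      rw [AlgHom.comp_apply, MvPolynomial.aeval_X, map_sub, map_mul, this, mul_zero, sub_zero]
    have h1 : Ideal.Quotient.mk J' (π G) = 0 := by
      rw [Ideal.Quotient.eq_zero_iff_mem, Ideal.mem_comap, h0]
      exact zero_mem _
    exact Ideal.Quotient.eq_zero_iff_mem.1 ((DFunLike.congr_fun hφ G).trans h1)
  · refine Ideal.span_le.2 ?_
    rintro _ ⟨i, rfl⟩
    refine Ideal.mem_map_of_mem _ (mem_vanishingIdeal_cone_segreProd.2 fun p _ q hq => ?_)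
    rw [hH] at hq
    exact (eval_segreForm A i (Fin.last m) p q).trans (mul_eq_zero_of_right _ hq)

/-- Evaluation at the vertex. -/
def evalVertex (m : ℕ) (V : Set (ℙ k (Fin (n + 1) → k))) : AffCoordRing (coneY m V) →ₐ[k] k :=
  Ideal.Quotient.liftₐ _ (MvPolynomial.aeval 0) fun _ hF => hF 0 (zero_mem_cone _)

theorem evalVertex_surjective : Function.Surjective (evalVertex m V) := fun c =>
  ⟨algebraMap k _ c, by rw [AlgHom.commutes]; rfl⟩

theorem vanishingIdeal_coneY_le :
    MvPolynomial.vanishingIdeal k (coneY m V) ≤ 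
      MvPolynomial.vanishingIdeal k ({0} : Set (Fin (n + 1) × Fin (m + 1) → k)) :=
  MvPolynomial.vanishingIdeal_anti_mono (by simpa using zero_mem_cone _)

theorem ker_evalVertex : RingHom.ker (evalVertex m V) = vertexIdeal m V := by
  ext r
  obtain ⟨F, rfl⟩ := Ideal.Quotient.mk_surjective r
  rw [vertexIdeal, idealIn, Ideal.mem_quotient_iff_mem vanishingIdeal_coneY_le,
    MvPolynomial.mem_vanishingIdeal_singleton_iff]
  rfl

theorem centerIdeal_le_vertexIdeal : centerIdeal V H ≤ vertexIdeal m V :=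
  Ideal.map_mono (MvPolynomial.vanishingIdeal_anti_mono (by simpa using zero_mem_cone _))

theorem eval_aeval_X_mul_C {ι : Type} (z : ι → k) (c : k) (F : MvPolynomial ι k) :
    Polynomial.eval c (MvPolynomial.aeval (fun i => Polynomial.X * Polynomial.C (z i)) F) =
      MvPolynomial.eval (c • z) F := by
  induction F using MvPolynomial.induction_on with
  | C a => simp
  | add F G hF hG => rw [map_add, Polynomial.eval_add, hF, hG, map_add]
  | mul_X F i hF =>
    rw [map_mul, Polynomial.eval_mul, hF, map_mul, MvPolynomial.aeval_X, MvPolynomial.eval_X,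
      Polynomial.eval_mul, Polynomial.eval_X, Polynomial.eval_C, Pi.smul_apply, smul_eq_mul]

/-- Restriction of functions on `C(V × ℙ^m)` to a line through the vertex. -/
def restrictLine [Infinite k] (p : Fin (n + 1) → k) (hp : p ∈ cone V) (q : Fin (m + 1) → k) :
    AffCoordRing (coneY m V) →ₐ[k] Polynomial k :=
  Ideal.Quotient.liftₐ _
    (MvPolynomial.aeval fun ij => Polynomial.X * Polynomial.C (tensorVec p q ij))
    fun F hF => by
      refine Polynomial.funext fun c => ?_
      rw [Polynomial.eval_zero]
      refine (eval_aeval_X_mul_C _ c F).trans ?_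
      rw [smul_tensorVec]
      exact mem_vanishingIdeal_cone_segreProd_univ.1 hF _ (smul_mem_cone hp c) q

section RestrictLine

variable [Infinite k] {p : Fin (n + 1) → k} (hp : p ∈ cone V) (q : Fin (m + 1) → k)

theorem eval_restrictLine_mk (c : k) (F : MvPolynomial (Fin (n + 1) × Fin (m + 1)) k) :
    Polynomial.eval c (restrictLine p hp q (Ideal.Quotient.mk _ F)) =
      MvPolynomial.eval (tensorVec (c • p) q) F := by
  rw [← smul_tensorVec]
  exact eval_aeval_X_mul_C _ c F

theorem restrictLine_mem_span_X {r : AffCoordRing (coneY m V)} (hr : r ∈ vertexIdeal m V) :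
    restrictLine p hp q r ∈ Ideal.span {Polynomial.X} := by
  obtain ⟨F, rfl⟩ := Ideal.Quotient.mk_surjective r
  rw [Ideal.mem_span_singleton, Polynomial.X_dvd_iff, Polynomial.coeff_zero_eq_eval_zero,
    eval_restrictLine_mk]
  rw [← ker_evalVertex] at hr
  have h0 : tensorVec ((0 : k) • p) q = 0 := by rw [← smul_tensorVec, zero_smul]
  rw [h0]
  exact hr

theorem restrictLine_segreCoord (i : Fin (n + 1)) (j : Fin (m + 1)) :
    restrictLine p hp q (segreCoord (coneY m V) A i j) =
      Polynomial.X * Polynomial.C (p i * A.mulVec q j) := by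
  refine Polynomial.funext fun c => ?_
  rw [← mk_segreForm, eval_restrictLine_mk, eval_segreForm]
  simp [mul_assoc]

end RestrictLine

include hA in
/-- The relations of degree `d` modulo `I ^ d 𝔪_v` between the coordinates that cut out
`C(V × H)` are the equations of `V`. -/
theorem aeval_segreCoord_mem_iff [Infinite k] (hV : V.Nonempty)
    {d : ℕ} {F : MvPolynomial (Fin (n + 1)) k} (hF : F.IsHomogeneous d) :
    MvPolynomial.aeval (fun i => segreCoord (coneY m V) A i (Fin.last m)) F ∈
      centerIdeal V H ^ d * vertexIdeal m V ↔ F ∈ (projIdeal V).toIdeal := by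
  rw [mem_projIdeal_iff hV]
  constructor
  · intro h p hp
    obtain ⟨q, hq⟩ := exists_mulVec_eq_one hA (Fin.last m)
    have hle : centerIdeal V H ^ d * vertexIdeal m V ≤
        (Ideal.span {Polynomial.X} ^ (d + 1)).comap (restrictLine p hp q) := by
      refine (Ideal.mul_mono_left (Ideal.pow_right_mono centerIdeal_le_vertexIdeal d)).trans ?_
      refine (pow_succ (vertexIdeal m V) d).ge.trans (le_trans ?_ (Ideal.le_comap_pow _ _))
      exact Ideal.pow_right_mono (fun r hr => restrictLine_mem_span_X hp q hr) _
    have h1 := hle h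
    rw [Ideal.mem_comap, Ideal.span_singleton_pow, Ideal.mem_span_singleton,
      Polynomial.X_pow_dvd_iff] at h1
    have h2 : restrictLine p hp q
        (MvPolynomial.aeval (fun i => segreCoord (coneY m V) A i (Fin.last m)) F) =
        Polynomial.X ^ d * Polynomial.C (MvPolynomial.eval p F) := by
      rw [← AlgHom.comp_apply, MvPolynomial.comp_aeval]
      simp only [restrictLine_segreCoord, hq, mul_one]
      rw [aeval_mul_of_isHomogeneous hF]
      congr 1
      have : MvPolynomial.aeval (fun i => (Polynomial.C (p i) : Polynomial k)) =
          (Polynomial.CAlgHom (R := k) (A := k)).comp (MvPolynomial.aeval (R := k) p) := by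
        ext i : 1
        simp
      exact DFunLike.congr_fun this F
    have h3 := h1 d (Nat.lt_succ_self d)
    rw [h2, mul_comm, Polynomial.coeff_C_mul_X_pow, if_pos rfl] at h3
    exact h3
  · intro h
    have h0 : MvPolynomial.aeval (fun i => segreCoord (coneY m V) A i (Fin.last m)) F =
        Ideal.Quotient.mk (MvPolynomial.vanishingIdeal k (coneY m V))
          (MvPolynomial.aeval (fun i => segreForm A i (Fin.last m)) F) := by
      have : MvPolynomial.aeval (fun i => segreCoord (coneY m V) A i (Fin.last m)) =
          (Ideal.Quotient.mkₐ k (MvPolynomial.vanishingIdeal k (coneY m V))).comp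
            (MvPolynomial.aeval (fun i => segreForm A i (Fin.last m))) := by
        ext i : 1
        rw [AlgHom.comp_apply, MvPolynomial.aeval_X, MvPolynomial.aeval_X]
        rfl
      exact DFunLike.congr_fun this F
    rw [h0, mk_eq_zero_iff.2]
    · exact zero_mem _
    · intro p hp q
      have : MvPolynomial.eval (tensorVec p q)
          (MvPolynomial.aeval (fun i => segreForm A i (Fin.last m)) F) =
          MvPolynomial.aeval (fun i => A.mulVec q (Fin.last m) * p i) F := by
        have : (MvPolynomial.aeval (tensorVec p q)).comp
            (MvPolynomial.aeval (fun i => segreForm A i (Fin.last m))) =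
            MvPolynomial.aeval (R := k) (fun i => A.mulVec q (Fin.last m) * p i) := by
          ext i : 1
          rw [AlgHom.comp_apply, MvPolynomial.aeval_X, MvPolynomial.aeval_X]
          exact (eval_segreForm A i _ p q).trans (mul_comm _ _)
        exact DFunLike.congr_fun this F
      rw [this, aeval_mul_of_isHomogeneous hF]
      exact (congrArg _ (h p hp)).trans (mul_zero _)

theorem segreCoord_mem_vertexIdeal (i : Fin (n + 1)) (j : Fin (m + 1)) :
    segreCoord (coneY m V) A i j ∈ vertexIdeal m V := by
  rw [← ker_evalVertex, ← mk_segreForm]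
  change MvPolynomial.eval 0 (segreForm A i j) = 0
  simp [segreForm]

include hA in
theorem vertexIdeal_le {J : Ideal (AffCoordRing (coneY m V))}
    (h : ∀ i j, segreCoord (coneY m V) A i j ∈ J) : vertexIdeal m V ≤ J := by
  have hX : ∀ i l, Ideal.Quotient.mk (MvPolynomial.vanishingIdeal k (coneY m V))
      (MvPolynomial.X (i, l)) ∈ J := by
    intro i l
    have : (MvPolynomial.X (i, l) : MvPolynomial (Fin (n + 1) × Fin (m + 1)) k) =
        ∑ j, MvPolynomial.C (A⁻¹ l j) * segreForm A i j := by
      simp only [segreForm, Finset.mul_sum, ← mul_assoc, ← map_mul]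
      rw [Finset.sum_comm]
      simp only [← Finset.sum_mul, ← map_sum]
      have : ∀ l', ∑ j, A⁻¹ l j * A j l' = (1 : Matrix (Fin (m + 1)) (Fin (m + 1)) k) l l' := by
        intro l'
        rw [← Matrix.nonsing_inv_mul _ hA, Matrix.mul_apply]
      simp [this, Matrix.one_apply]
    rw [this, map_sum]
    refine Ideal.sum_mem _ fun j _ => ?_
    rw [map_mul]
    exact Ideal.mul_mem_left _ _ (h i j)
  have key : ∀ F : MvPolynomial (Fin (n + 1) × Fin (m + 1)) k,
      Ideal.Quotient.mk (MvPolynomial.vanishingIdeal k (coneY m V))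
        (F - MvPolynomial.C (MvPolynomial.eval 0 F)) ∈ J := by
    intro F
    induction F using MvPolynomial.induction_on with
    | C a => simp
    | add F G hF hG =>
      have : F + G - MvPolynomial.C (MvPolynomial.eval 0 (F + G)) =
        (F - MvPolynomial.C (MvPolynomial.eval 0 F)) +
          (G - MvPolynomial.C (MvPolynomial.eval 0 G)) := by
        rw [map_add, map_add]; ring
      rw [this, map_add]
      exact add_mem hF hG
    | mul_X F il hF =>
      rw [map_mul, MvPolynomial.eval_X, Pi.zero_apply, mul_zero, map_zero, sub_zero, map_mul]
      exact Ideal.mul_mem_left _ _ (hX _ _)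
  intro r hr
  obtain ⟨F, rfl⟩ := Ideal.Quotient.mk_surjective r
  rw [← ker_evalVertex] at hr
  have h0 : MvPolynomial.eval 0 F = 0 := hr
  have h1 := key F
  rwa [h0, map_zero, sub_zero] at h1

include hA in
theorem complVertex_eq_iSup : complVertex m V =
    iSup (α := (Spec (.of (AffCoordRing (coneY m V)))).Opens)
      fun ij : {ij : Fin (n + 1) × Fin (m + 1) // segreCoord (coneY m V) A ij.1 ij.2 ≠ 0} =>
        PrimeSpectrum.basicOpen (segreCoord (coneY m V) A ij.1.1 ij.1.2) := by
  refine SetLike.ext fun x => ?_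
  refine Iff.trans ?_ TopologicalSpace.Opens.mem_iSup.symm
  change x ≠ vertex m V ↔ _
  have hx := x.isPrime
  constructor
  · intro hne
    by_contra! hall
    refine hne (PrimeSpectrum.ext ?_)
    refine ((idealIn_singleton_isMaximal (coneY m V) 0 (zero_mem_cone _)).eq_of_le hx.ne_top
      (vertexIdeal_le hA fun i j => ?_)).symm
    by_cases h : segreCoord (coneY m V) A i j = 0
    · rw [h]; exact zero_mem _
    · have := hall ⟨(i, j), h⟩
      exact not_not.1 this
  · rintro ⟨ij, h⟩ rfl
    exact h (segreCoord_mem_vertexIdeal _ _)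

include hA in
/-- The blowing up of `C(V × ℙ^m)` along `C(V × H)` is an isomorphism away from the vertex. -/
theorem isIso_coneBlowupMap_restrict [IsDomain (AffCoordRing (coneY m V))]
    (hH : cone H = {q | A.mulVec q (Fin.last m) = 0}) :
    IsIso (coneBlowupMap V H ∣_ complVertex m V) := by
  rw [complVertex_eq_iSup hA]
  refine isIso_morphismRestrict_iSup _ _ fun ij => ?_
  have hI := centerIdeal_eq_span (V := V) hA hH
  refine isIso_blowupMap_restrict_basicOpen
    (a := segreCoord (coneY m V) A ij.1.1 (Fin.last m)) ?_ (fun b hb => ?_)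
    (mem_nonZeroDivisors_of_ne_zero (segreCoord_last_ne_zero hA ij.2))
  · rw [hI]
    exact Ideal.subset_span ⟨_, rfl⟩
  · rw [hI] at hb
    induction hb using Submodule.span_induction with
    | mem b hb =>
      obtain ⟨i, rfl⟩ := hb
      exact ⟨segreCoord (coneY m V) A i ij.1.2, by
        rw [segreCoord_mul_segreCoord, mul_comm]⟩
    | zero => simp
    | add b c _ _ ihb ihc =>
      rw [mul_add]
      exact dvd_add ihb ihc
    | smul r b _ ihb =>
      rw [smul_eq_mul, mul_left_comm]
      exact ihb.mul_left _

end SegreCone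

end

end ConeBlowup

namespace ConeBlowup

noncomputable section

section Over

theorem nonempty_over_iso_of_comp_eq {C : Type*} [Category* C] {F P X Y S : C} (e : F ≅ P)
    {i : P ⟶ X} {ι : F ⟶ X} {f : X ⟶ Y} {c : P ⟶ S} {g : S ⟶ Y} {s : Y ⟶ S}
    (he : e.hom ≫ i = ι) (w : i ≫ f = c ≫ g) (hs : g ≫ s = 𝟙 S) :
    Nonempty (Over.mk (ι ≫ f ≫ s) ≅ Over.mk c) :=
  ⟨Over.isoMk e (by
    change e.hom ≫ c = ι ≫ f ≫ s
    rw [← he, Category.assoc, reassoc_of% w, hs, Category.comp_id])⟩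

/-- An isomorphism of graded rings over a homomorphism `R → K` with a section `Spec R → Spec K`
induces an isomorphism of `Proj` over `K`. -/
theorem nonempty_over_iso_proj {R A K B : Type u} [CommRing R] [CommRing A] [Algebra R A]
    {𝒜 : ℕ → Submodule R A} [GradedAlgebra 𝒜] [CommRing K] [CommRing B] [Algebra K B]
    {ℬ : ℕ → Submodule K B} [GradedAlgebra ℬ] (ρ : R →+* K) (e : A ≃+* B)
    (he : ∀ d a, a ∈ 𝒜 d ↔ e a ∈ ℬ d)
    (hρ : ∀ r, e (algebraMap R A r) = algebraMap K B (ρ r)) {s : Spec (.of R) ⟶ Spec (.of K)}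
    (hs : Spec.map (CommRingCat.ofHom ρ) ≫ s = 𝟙 _) :
    Nonempty (Over.mk (projToSpec 𝒜 ≫ s) ≅ Over.mk (projToSpec ℬ)) :=
  ⟨Over.isoMk (projIsoOfEquiv e he) (by
    have h := projIsoOfEquiv_inv_projToSpec ρ e he hρ
    rw [Iso.inv_comp_eq] at h
    change (projIsoOfEquiv e he).hom ≫ projToSpec ℬ = projToSpec 𝒜 ≫ s
    rw [h, Category.assoc, Category.assoc, hs, Category.comp_id])⟩

attribute [local instance] MvPolynomial.gradedAlgebra

variable {k R : Type u} [Field k] [CommRing R] [Algebra k R] {ι : Type} (I 𝔪 : Ideal R)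
  (z : ι → R) (hz : ∀ i, z i ∈ I ^ 1)
  (P : HomogeneousIdeal (MvPolynomial.homogeneousSubmodule ι k))
  (hP : ∀ d (F : MvPolynomial ι k), F.IsHomogeneous d →
    (MvPolynomial.aeval z F ∈ I ^ d * 𝔪 ↔ F ∈ P.toIdeal))
  (ρ : R →ₐ[k] k) (hρ : RingHom.ker ρ = 𝔪)

theorem specMap_comp_specMap_algebraMap :
    Spec.map (CommRingCat.ofHom (ρ : R →+* k)) ≫
      Spec.map (CommRingCat.ofHom (algebraMap k R)) = 𝟙 _ := by
  rw [← Spec.map_comp, ← CommRingCat.ofHom_comp, AlgHom.comp_algebraMap]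
  exact Spec.map_id _

include hz hP hρ in
theorem nonempty_over_iso_fiberProj (hI : I = Ideal.span (Set.range z)) :
    Nonempty (Over.mk (fiberProjToSpec I 𝔪 ≫ Spec.map (CommRingCat.ofHom (algebraMap k R))) ≅
      Over.mk (projToSpec (A := MvPolynomial ι k ⧸ P.toIdeal)
        (quotGrading (MvPolynomial.homogeneousSubmodule ι k) P.toIdeal))) := by
  let φ : FiberRing I 𝔪 ≃+* MvPolynomial ι k ⧸ P.toIdeal :=
    fiberRingEquiv I 𝔪 z hz P hP ρ hρ hI
  have h1 : ∀ d a, a ∈ fiberGrading I 𝔪 d ↔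
      φ a ∈ quotGrading (MvPolynomial.homogeneousSubmodule ι k) P.toIdeal d :=
    mem_fiberGrading_iff I 𝔪 z hz P hP ρ hρ hI
  have h2 : ∀ r, φ (algebraMap R (FiberRing I 𝔪) r) =
      algebraMap k (MvPolynomial ι k ⧸ P.toIdeal) ((ρ : R →+* k) r) :=
    reesToQuot_algebraMap I 𝔪 z hz P hP ρ hρ hI
  exact nonempty_over_iso_proj (A := FiberRing I 𝔪) (B := MvPolynomial ι k ⧸ P.toIdeal)
    (ρ : R →+* k) φ h1 h2 (specMap_comp_specMap_algebraMap ρ)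

end Over

section Points

attribute [local instance] MvPolynomial.gradedAlgebra
open Graded

/-- The kernel of a homomorphism from a graded ring to a graded domain is a point of `Proj`. -/
theorem exists_proj_eq_ker {R A K B : Type u} [CommRing R] [CommRing A] [Algebra R A]
    {𝒜 : ℕ → Submodule R A} [GradedAlgebra 𝒜] [CommRing K] [CommRing B] [Algebra K B]
    {ℬ : ℕ → Submodule K B} [GradedAlgebra ℬ] [IsDomain B] (e : A →+* B)
    (he : ∀ d, ∀ a ∈ 𝒜 d, e a ∈ ℬ d) (h : ∃ a ∈ 𝒜 1, e a ≠ 0) :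
    ∃ x : Proj 𝒜, ∀ a, a ∈ x.asHomogeneousIdeal ↔ e a = 0 := by
  classical
  let f : 𝒜 →+*ᵍ ℬ := ⟨e, fun {d a} h => he d a h⟩
  have hhom : (RingHom.ker e).IsHomogeneous 𝒜 := by
    intro d a ha
    change f _ = 0
    rw [GradedRingHom.map_directSumDecompose, show f a = 0 from ha]
    simp
  let J : HomogeneousIdeal 𝒜 := ⟨RingHom.ker e, hhom⟩
  refine ⟨(⟨J, RingHom.ker_isPrime e, fun hle => ?_⟩ : ProjectiveSpectrum 𝒜), fun a => Iff.rfl⟩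
  obtain ⟨a, ha, h0⟩ := h
  exact h0 (hle (HomogeneousIdeal.mem_irrelevant_of_mem 𝒜 one_pos ha))

variable {k : Type u} [Field k] [Infinite k] {ι : Type} {V : Set (ℙ k (ι → k))}

theorem exists_mem_projCoordGrading_one_ne_zero (hV : V.Nonempty) :
    ∃ a ∈ projCoordGrading V 1, a ≠ 0 := by
  obtain ⟨p, hp⟩ := hV
  obtain ⟨i, hi⟩ := Function.ne_iff.1 p.rep_nonzero
  refine ⟨Ideal.Quotient.mk _ (MvPolynomial.X i), ⟨_, MvPolynomial.isHomogeneous_X k i, rfl⟩,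
    fun h0 => hi ?_⟩
  rw [Ideal.Quotient.eq_zero_iff_mem, mem_projIdeal_iff ⟨p, hp⟩] at h0
  simpa using h0 _ (rep_mem_cone hp)

theorem projIdeal_singleton_isPrime (p : ℙ k (ι → k)) : (projIdeal {p}).toIdeal.IsPrime :=
  projIdeal_isPrime (Set.singleton_nonempty p) fun A B _ _ h => by
    simpa only [Set.singleton_subset_iff, Set.mem_union] using h

/-- The point of the scheme `Proj (k[x] / I(V))` given by a point of `V`. -/
theorem exists_proj_point {p : ℙ k (ι → k)} (hp : p ∈ V) :
    ∃ x : Proj (projCoordGrading V), ∀ F : MvPolynomial ι k,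
      Ideal.Quotient.mk (projIdeal V).toIdeal F ∈ x.asHomogeneousIdeal ↔
        F ∈ (projIdeal {p}).toIdeal := by
  have hprime := projIdeal_singleton_isPrime p
  have hdom : IsDomain (ProjCoordRing {p}) := Ideal.Quotient.isDomain _
  have hle : (projIdeal V).toIdeal ≤ (projIdeal {p}).toIdeal := by
    intro F hF
    rw [mem_projIdeal_iff ⟨p, hp⟩] at hF
    rw [mem_projIdeal_iff (Set.singleton_nonempty p)]
    intro z hz
    refine hF z fun h0 => ?_
    rw [show Projectivization.mk k z h0 = p from hz h0]
    exact hp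
  obtain ⟨x, hx⟩ := exists_proj_eq_ker (A := ProjCoordRing V) (B := ProjCoordRing {p})
    (𝒜 := projCoordGrading V) (ℬ := projCoordGrading {p}) (Ideal.Quotient.factor hle) (by
      rintro d _ ⟨F, hF, rfl⟩
      exact ⟨F, hF, rfl⟩) (by
      obtain ⟨_, ⟨F, hF, rfl⟩, h0⟩ :=
        exists_mem_projCoordGrading_one_ne_zero (Set.singleton_nonempty p)
      exact ⟨Ideal.Quotient.mk _ F, ⟨F, hF, rfl⟩, h0⟩)
  exact ⟨x, fun F => (hx _).trans Ideal.Quotient.eq_zero_iff_mem⟩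

theorem projIdeal_singleton_injective :
    Function.Injective fun p : ℙ k (ι → k) => (projIdeal {p}).toIdeal := by
  intro p q h
  obtain ⟨i, hi⟩ := Function.ne_iff.1 p.rep_nonzero
  have key : ∀ j, p.rep i * q.rep j = q.rep i * p.rep j := by
    intro j
    have h1 : (MvPolynomial.C (p.rep i) * MvPolynomial.X j -
        MvPolynomial.C (p.rep j) * MvPolynomial.X i : MvPolynomial ι k) ∈
          (projIdeal {p}).toIdeal := by
      refine (mem_projIdeal_iff (Set.singleton_nonempty p)).2 fun z hz => ?_
      obtain ⟨p', rfl, c, rfl⟩ := exists_smul_rep_of_mem_cone (Set.singleton_nonempty p) hz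
      simp
      ring
    rw [show (projIdeal {p}).toIdeal = (projIdeal {q}).toIdeal from h] at h1
    have h2 := (mem_projIdeal_iff (Set.singleton_nonempty q)).1 h1 _ (rep_mem_cone rfl)
    simp at h2
    linear_combination h2
  rw [← p.mk_rep, ← q.mk_rep, Projectivization.mk_eq_mk_iff']
  have hq : q.rep i ≠ 0 := by
    intro h0
    refine q.rep_nonzero (funext fun j => ?_)
    have := key j
    rw [h0, zero_mul, mul_eq_zero] at this
    exact this.resolve_left hi
  refine ⟨p.rep i / q.rep i, funext fun j => ?_⟩
  rw [Pi.smul_apply, smul_eq_mul, div_mul_eq_mul_div, key j, mul_div_cancel_left₀ _ hq]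

theorem nontrivial_proj (hV : V.Nontrivial) : Nontrivial (Proj (projCoordGrading V)) := by
  obtain ⟨p, hp, q, hq, hne⟩ := hV
  obtain ⟨x, hx⟩ := exists_proj_point hp
  obtain ⟨y, hy⟩ := exists_proj_point hq
  refine ⟨x, y, ?_⟩
  rintro rfl
  exact hne (projIdeal_singleton_injective (Ideal.ext fun F => (hx F).symm.trans (hy F)))

end Points

end

end ConeBlowup

theorem blowup_of_cone_along_cone_proj (k : Type u) [Field k] [IsAlgClosed k] (n m : ℕ)
    (V : Set (ℙ k (Fin (n + 1) → k))) (hV : IsSmoothProjVariety V)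
    (H : Set (ℙ k (Fin (m + 1) → k))) (hH : IsHyperplane H) :
    -- the blowing up is an isomorphism over the complement of the vertex
    IsIso (coneBlowupMap V H ∣_ complVertex m V) ∧
    -- the scheme-theoretic preimage of the vertex is isomorphic to `V` over `k`
    Nonempty (Over.mk ((coneBlowupMap V H).fiberι (vertex m V) ≫ coneBlowupMap V H ≫
      affStr (coneY m V)) ≅ Over.mk (projStr V)) ∧
    -- its support is the exceptional locus, unless `V` is a point
    (V.Nontrivial → exceptionalLocus (coneBlowupMap V H) = coneBlowupMap V H ⁻¹' {vertex m V}) ∧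
    -- in suitable Segre coordinates, in which `H` is the hyperplane `y'_m = 0`:
    (∃ A : Matrix (Fin (m + 1)) (Fin (m + 1)) k, IsUnit A.det ∧
      H = {q | A.mulVec q.rep (Fin.last m) = 0} ∧
      -- the ideal `I` of `Z` is generated by the `z'_{im}`
      centerIdeal V H =
        Ideal.span (Set.range fun i => segreCoord (coneY m V) A i (Fin.last m)) ∧
      -- `⨁ I^d / I^d 𝔪_v` is `k[x_0, …, x_n] / I(V)` as a graded `k`-algebra, the class of
      -- `z'_{im}` in degree one corresponding to `x_i`
      ∃ φ : FiberRing (centerIdeal V H) (vertexIdeal m V) ≃ₐ[k] ProjCoordRing V,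
        (∀ (d : ℕ) (a : FiberRing (centerIdeal V H) (vertexIdeal m V)),
          a ∈ fiberGrading (centerIdeal V H) (vertexIdeal m V) d ↔ φ a ∈ projCoordGrading V d) ∧
        ∀ i : Fin (n + 1),
          ∃ hi : segreCoord (coneY m V) A i (Fin.last m) ∈ centerIdeal V H ^ 1,
            φ (Ideal.Quotient.mk _
              (reesMonomial (centerIdeal V H) 1 (segreCoord (coneY m V) A i (Fin.last m)) hi)) =
              Ideal.Quotient.mk _ (MvPolynomial.X i)) ∧
    -- `Proj (⨁ I^d / I^d 𝔪_v)` is isomorphic to `V` over `k`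
    Nonempty (Over.mk (fiberProjToSpec (centerIdeal V H) (vertexIdeal m V) ≫
      affStr (coneY m V)) ≅ Over.mk (projStr V)) := by
  let _ : GradedAlgebra (MvPolynomial.homogeneousSubmodule (Fin (n + 1)) k) :=
    MvPolynomial.gradedAlgebra
  obtain ⟨l, hl, hHl⟩ := hH
  obtain ⟨A, hA, hAl⟩ := exists_matrix_mulVec_last l hl
  have hcone : cone H = {q | A.mulVec q (Fin.last m) = 0} := by
    rw [hHl, cone_hyperplane]
    simp only [hAl]
  have hprime := projIdeal_isPrime hV.nonempty hV.irreducible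
  have hdomS : IsDomain (ProjCoordRing V) := Ideal.Quotient.isDomain _
  have hprimeY : (MvPolynomial.vanishingIdeal k (coneY m V)).IsPrime :=
    vanishingIdeal_cone_isPrime hV.nonempty hprime
  have hdomR : IsDomain (AffCoordRing (coneY m V)) := Ideal.Quotient.isDomain _
  have hI := centerIdeal_eq_span (V := V) hA hcone
  have hz : ∀ i, segreCoord (coneY m V) A i (Fin.last m) ∈ centerIdeal V H ^ 1 := fun i => by
    rw [pow_one, hI]
    exact Ideal.subset_span ⟨i, rfl⟩
  have hP := fun d (F : MvPolynomial (Fin (n + 1)) k) (hF : F.IsHomogeneous d) =>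
    aeval_segreCoord_mem_iff (V := V) (H := H) hA hV.nonempty hF
  have hiso := isIso_coneBlowupMap_restrict (V := V) hA hcone
  let ρ := evalVertex m V
  have hρ : RingHom.ker ρ = vertexIdeal m V := ker_evalVertex
  obtain ⟨i, hi⟩ := exists_isPullback_proj (A := reesAlgebra (centerIdeal V H))
    (B := ProjCoordRing V) (𝒜 := reesGrading (centerIdeal V H)) (ℬ := projCoordGrading V)
    (ρ : AffCoordRing (coneY m V) →+* k)
    (reesToQuot _ _ _ hz (projIdeal V) hP ρ hρ hI) (reesToQuot_mem _ _ _ hz _ hP ρ hρ hI)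
    (reesToQuot_algebraMap _ _ _ hz _ hP ρ hρ hI) (reesToQuot_surjective _ _ _ hz _ hP ρ hρ hI)
    evalVertex_surjective (mem_smul_of_reesToQuot_eq_zero _ _ _ hz _ hP ρ hρ hI)
  obtain ⟨e, he⟩ := exists_fiber_iso_of_isPullback (coneBlowupMap V H) (vertex m V)
    (CommRingCat.ofHom (ρ : AffCoordRing (coneY m V) →+* k)) evalVertex_surjective hρ i _ hi
  refine ⟨hiso, nonempty_over_iso_of_comp_eq e he hi.w (specMap_comp_specMap_algebraMap ρ), fun hnt => Set.Subset.antisymm ?_ ?_, ⟨A, hA, ?_, hI,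
    fiberRingEquiv _ _ _ hz (projIdeal V) hP ρ hρ hI, mem_fiberGrading_iff _ _ _ hz _ hP ρ hρ hI,
    fun i => ⟨hz i, fiberRingEquiv_reesMonomial _ _ _ hz _ hP ρ hρ hI i⟩⟩, ?_⟩
  · have h := exceptionalLocus_subset_of_isIso (coneBlowupMap V H) _ hiso
    refine h.trans fun x hx => ?_
    exact not_not.1 hx
  · have hsm := hV.smooth
    have hjac : JacobsonSpace (Proj (projCoordGrading V)) :=
      LocallyOfFiniteType.jacobsonSpace (projStr V)
    have hpre : PreconnectedSpace (Proj (projCoordGrading V)) :=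
      preconnectedSpace_proj (A := ProjCoordRing V) _
        (exists_mem_projCoordGrading_one_ne_zero hV.nonempty)
    have hnt' := nontrivial_proj hnt
    have h1 : JacobsonSpace ((coneBlowupMap V H).fiber (vertex m V)) :=
      JacobsonSpace.of_isOpenEmbedding e.hom.homeomorph.isOpenEmbedding
    have h2 : PreconnectedSpace ((coneBlowupMap V H).fiber (vertex m V)) :=
      e.inv.homeomorph.surjective.denseRange.preconnectedSpace e.inv.homeomorph.continuous
    have h3 : Nontrivial ((coneBlowupMap V H).fiber (vertex m V)) :=
      e.inv.homeomorph.injective.nontrivial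
    exact preimage_subset_exceptionalLocus _ _
  · rw [hHl]
    simp only [hAl]
  · exact nonempty_over_iso_fiberProj (R := AffCoordRing (coneY m V)) _ _ _ hz (projIdeal V) hP
      ρ hρ hI
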